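/- Let C be an algebra of global dimension 2, B = C ⋉ Ext^2_C(DC,C), and M a τ_C-rigid C-module with projective cover P_0 → M in mod C. If Hom_C(τ_C^{-1}Ω_C^{-1}P_0, X) = 0 for every module X ∈ Gen M, then M is τ_B-rigid. In particular, if pd_C X ≤ 1 for every X ∈ Gen M, then M is τ_B-rigid. -/

import Mathlib

open CategoryTheory MulOpposite

open CategoryTheory MulOpposite

/-! Core definitions: right `A`-modules are modules over `Aᵐᵒᵖ`. -/

/-- The category of (small) modules over a ring `R`.  For a `k`-algebra `A`,
right `A`-modules are `Mdl Aᵐᵒᵖ`. -/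
abbrev Mdl (R : Type) [Ring R] := ModuleCat.{0} R

section Generic

variable (R : Type) [Ring R]

/-- `f : P → M` is a projective cover: `P` projective, `f` surjective with
superfluous kernel. -/
def IsProjCover {P M : Mdl R} (f : P →ₗ[R] M) : Prop :=
  Module.Projective R P ∧ Function.Surjective f ∧
    ∀ N : Submodule R P, N ⊔ LinearMap.ker f = ⊤ → N = ⊤

/-- `f : M → I` is an injective envelope: `I` injective, `f` injective with
essential image. -/
def IsInjEnv {M I : Mdl R} (f : M →ₗ[R] I) : Prop :=
  Module.Injective R I ∧ Function.Injective f ∧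
    ∀ K : Submodule R I, K ⊓ LinearMap.range f = ⊥ → K = ⊥

/-- `Hom_R(X, Y) = 0`. -/
def HomZero (X Y : Mdl R) : Prop := ∀ f : X →ₗ[R] Y, f = 0

/-- `X ∈ Gen M`: `X` is an epimorphic image of a finite direct sum of copies of `M`. -/
def MemGen (M X : Mdl R) : Prop :=
  ∃ (d : ℕ) (f : (Fin d → M) →ₗ[R] X), Function.Surjective f

/-- `X ∈ add M`: `X` is a direct summand of a finite direct sum of copies of `M`. -/
def MemAdd (M X : Mdl R) : Prop :=
  ∃ (n : ℕ) (s : X →ₗ[R] (Fin n → M)) (r : (Fin n → M) →ₗ[R] X),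
    r.comp s = LinearMap.id

/-- projective dimension at most 1: a length-one projective resolution exists. -/
def PdLE1 (M : Mdl R) : Prop :=
  ∃ (P1 P0 : Mdl R) (d1 : P1 →ₗ[R] P0) (d0 : P0 →ₗ[R] M),
    Module.Projective R P1 ∧ Module.Projective R P0 ∧
    Function.Injective d1 ∧ Function.Surjective d0 ∧
    LinearMap.range d1 = LinearMap.ker d0

/-- projective dimension at most 2. -/
def PdLE2 (M : Mdl R) : Prop :=
  ∃ (P2 P1 P0 : Mdl R) (d2 : P2 →ₗ[R] P1) (d1 : P1 →ₗ[R] P0) (d0 : P0 →ₗ[R] M),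
    Module.Projective R P2 ∧ Module.Projective R P1 ∧ Module.Projective R P0 ∧
    Function.Injective d2 ∧ Function.Surjective d0 ∧
    LinearMap.range d2 = LinearMap.ker d1 ∧ LinearMap.range d1 = LinearMap.ker d0

/-- injective dimension at most 1. -/
def IdLE1 (M : Mdl R) : Prop :=
  ∃ (I0 I1 : Mdl R) (d0 : M →ₗ[R] I0) (d1 : I0 →ₗ[R] I1),
    Module.Injective R I0 ∧ Module.Injective R I1 ∧
    Function.Injective d0 ∧ Function.Surjective d1 ∧
    LinearMap.range d0 = LinearMap.ker d1

/-- global dimension at most 2 (every module has projective dimension ≤ 2). -/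
def GlDimLE2 : Prop := ∀ M : Mdl R, PdLE2 R M

/-- global dimension exactly 2. -/
def GlDimEq2 : Prop := GlDimLE2 R ∧ ¬ ∀ M : Mdl R, PdLE1 R M

/-- `W` is a first syzygy `Ω M` of `M` (kernel of a projective cover). -/
def IsSyzygy (M W : Mdl R) : Prop :=
  ∃ (P : Mdl R) (f : P →ₗ[R] M), IsProjCover R f ∧
    Nonempty (W ≃ₗ[R] LinearMap.ker f)

/-- `W` is a first cosyzygy `Ω⁻¹ M` of `M` (cokernel of an injective envelope). -/
def IsCosyzygy (M W : Mdl R) : Prop :=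
  ∃ (I : Mdl R) (f : M →ₗ[R] I), IsInjEnv R f ∧
    Nonempty (W ≃ₗ[R] (I ⧸ LinearMap.range f))

/-- `P1 --d1--> P0 --d0--> M → 0` is a minimal projective presentation. -/
def IsMinPres {P1 P0 M : Mdl R} (d1 : P1 →ₗ[R] P0) (d0 : P0 →ₗ[R] M) : Prop :=
  IsProjCover R d0 ∧ Module.Projective R P1 ∧
  LinearMap.range d1 = LinearMap.ker d0 ∧
  ∀ N : Submodule R P1, N ⊔ LinearMap.ker d1 = ⊤ → N = ⊤

/-- `Ext¹_R(X, Y) = 0`, expressed as: every short exact sequence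
`0 → Y → Z → X → 0` splits. -/
def Ext1Zero (X Y : Mdl R) : Prop :=
  ∀ (Z : Mdl R) (i : Y →ₗ[R] Z) (p : Z →ₗ[R] X),
    Function.Injective i → Function.Surjective p →
    LinearMap.range i = LinearMap.ker p →
    ∃ s : X →ₗ[R] Z, p.comp s = LinearMap.id

/-- partial tilting module: `pd ≤ 1` and `Ext¹(M,M) = 0`. -/
def PartialTilting (M : Mdl R) : Prop := PdLE1 R M ∧ Ext1Zero R M M

/-- tilting module: partial tilting plus a coresolution
`0 → R → T' → T'' → 0` with `T', T'' ∈ add M` of the regular module. -/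
def IsTilting (M : Mdl R) : Prop :=
  PartialTilting R M ∧
  ∃ (T' T'' : Mdl R) (i : ModuleCat.of R R →ₗ[R] T') (p : T' →ₗ[R] T''),
    MemAdd R M T' ∧ MemAdd R M T'' ∧
    Function.Injective i ∧ Function.Surjective p ∧
    LinearMap.range i = LinearMap.ker p

/-- an indecomposable (nonzero) module. -/
def Indecomp (M : Mdl R) : Prop :=
  Nontrivial M ∧ ∀ (U V : Submodule R M), IsCompl U V → U = ⊥ ∨ V = ⊥

/-- the number of isomorphism classes of simple `R`-modules is `n`. -/
def SimpleCount (n : ℕ) : Prop :=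
  ∃ S : Fin n → Mdl R,
    (∀ i, IsSimpleModule R (S i)) ∧
    (∀ i j, Nonempty ((S i) ≃ₗ[R] (S j)) → i = j) ∧
    ∀ X : Mdl R, IsSimpleModule R X → ∃ i, Nonempty (X ≃ₗ[R] S i)

end Generic

section Duality

variable (k : Type) [Field k] (A : Type) [Ring A] [Algebra k A]

/-- `N` (a right `A`-module) is the `k`-linear dual `D M` of the left `A`-module `M`:
witnessed by a nondegenerate balanced `k`-bilinear pairing. -/
def IskDual (N : Mdl Aᵐᵒᵖ) (M : Mdl A) : Prop :=
  ∃ φ : N → M → k,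
    (∀ n n' m, φ (n + n') m = φ n m + φ n' m) ∧
    (∀ n m m', φ n (m + m') = φ n m + φ n m') ∧
    (∀ (c : k) n m, φ n ((algebraMap k A c) • m) = c * φ n m) ∧
    (∀ (a : A) n m, φ (op a • n) m = φ n (a • m)) ∧
    (∀ n, (∀ m, φ n m = 0) → n = 0) ∧
    (∀ m, (∀ n, φ n m = 0) → m = 0)

/-- `T = τ M`: the Auslander–Reiten translate of the right `A`-module `M`,
i.e. the `k`-dual of the transpose `Tr M` computed from a minimal projective
presentation. -/
def IsTau (M T : Mdl Aᵐᵒᵖ) : Prop :=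
  ∃ (P1 P0 : Mdl Aᵐᵒᵖ) (d1 : P1 →ₗ[Aᵐᵒᵖ] P0) (d0 : P0 →ₗ[Aᵐᵒᵖ] M),
    IsMinPres Aᵐᵒᵖ d1 d0 ∧
    ∃ (Tr : Mdl A) (q : (P1 →ₗ[Aᵐᵒᵖ] A) →ₗ[A] Tr),
      Function.Surjective q ∧
      (∀ g : P1 →ₗ[Aᵐᵒᵖ] A, q g = 0 ↔ ∃ f : P0 →ₗ[Aᵐᵒᵖ] A, g = f.comp d1) ∧
      IskDual k A T Tr

/-- `T = τ⁻¹ M`: the inverse Auslander–Reiten translate, `Tr (D M)`, computed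
from a minimal projective presentation of the left module `D M`. -/
def IsTauInv (M T : Mdl Aᵐᵒᵖ) : Prop :=
  ∃ (DM : Mdl A), IskDual k A M DM ∧
  ∃ (Q1 Q0 : Mdl A) (d1 : Q1 →ₗ[A] Q0) (d0 : Q0 →ₗ[A] DM),
    IsMinPres A d1 d0 ∧
    ∃ q : (Q1 →ₗ[A] A) →ₗ[Aᵐᵒᵖ] T,
      Function.Surjective q ∧
      ∀ g : Q1 →ₗ[A] A, q g = 0 ↔ ∃ f : Q0 →ₗ[A] A, g = f.comp d1

/-- `W = τ⁻¹ Ω⁻¹ M`. -/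
def IsTauInvCosyz (M W : Mdl Aᵐᵒᵖ) : Prop :=
  ∃ V, IsCosyzygy Aᵐᵒᵖ M V ∧ IsTauInv k A V W

/-- `W = τ Ω M`. -/
def IsTauSyz (M W : Mdl Aᵐᵒᵖ) : Prop :=
  ∃ V, IsSyzygy Aᵐᵒᵖ M V ∧ IsTau k A V W

/-- `M` is `τ`-rigid: `Hom(M, τM) = 0`. -/
def TauRigid (M : Mdl Aᵐᵒᵖ) : Prop :=
  ∀ T, IsTau k A M T → HomZero Aᵐᵒᵖ M T

/-- `M` is `τ`-tilting: `τ`-rigid with as many pairwise nonisomorphic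
indecomposable summands as there are simple modules. -/
def TauTilting (M : Mdl Aᵐᵒᵖ) : Prop :=
  TauRigid k A M ∧
  ∃ (n : ℕ) (N : Fin n → Mdl Aᵐᵒᵖ),
    (∀ i, Indecomp Aᵐᵒᵖ (N i)) ∧
    (∀ i j, Nonempty ((N i) ≃ₗ[Aᵐᵒᵖ] (N j)) → i = j) ∧
    Nonempty (M ≃ₗ[Aᵐᵒᵖ] ((i : Fin n) → N i)) ∧
    SimpleCount Aᵐᵒᵖ n

end Duality


section SplitExt

variable {B C : Type} [Ring B] [Ring C]

/-- a right `C`-module viewed as a right `B`-module via a ring hom `π : B → C`. -/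
def modAlong (π : B →+* C) (M : Mdl Cᵐᵒᵖ) : Mdl Bᵐᵒᵖ :=
  letI : Module Bᵐᵒᵖ M := Module.compHom M (RingHom.op π)
  ModuleCat.of _ M

/-- `X` is the induced module `M ⊗_C B` along `σ : C → B`, characterized by the
universal property of induction (extension of scalars). -/
def IsInducedAlong (σ : C →+* B) (M : Mdl Cᵐᵒᵖ) (X : Mdl Bᵐᵒᵖ) : Prop :=
  ∃ φ : M →+ X,
    (∀ (c : C) (m : M), φ (op c • m) = op (σ c) • φ m) ∧
    ∀ (Y : Mdl Bᵐᵒᵖ) (ψ : M →+ Y),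
      (∀ (c : C) (m : M), ψ (op c • m) = op (σ c) • ψ m) →
      ∃! h : X →ₗ[Bᵐᵒᵖ] Y, ∀ m, h (φ m) = ψ m

/-- `X` is the coinduced module `D(B ⊗_C D M) ≅ Hom_C(B, M)` along `σ : C → B`,
characterized by the universal property of coinduction. -/
def IsCoinducedAlong (σ : C →+* B) (M : Mdl Cᵐᵒᵖ) (X : Mdl Bᵐᵒᵖ) : Prop :=
  ∃ p : X →+ M,
    (∀ (c : C) (x : X), p (op (σ c) • x) = op c • p x) ∧
    ∀ (Y : Mdl Bᵐᵒᵖ) (ψ : Y →+ M),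
      (∀ (c : C) (y : Y), ψ (op (σ c) • y) = op c • ψ y) →
      ∃! h : Y →ₗ[Bᵐᵒᵖ] X, ∀ y, p (h y) = ψ y

end SplitExt

section TrivExt

variable (C : Type) [Ring C] (E : Type) [AddCommGroup E]
  [Module C E] [Module Cᵐᵒᵖ E] [SMulCommClass C Cᵐᵒᵖ E]

/-- the projection `B = C ⋉ E → C` as a ring hom. -/
def tszeFst : TrivSqZeroExt C E →+* C where
  toFun := TrivSqZeroExt.fst
  map_one' := rfl
  map_mul' _ _ := rfl
  map_zero' := rfl
  map_add' _ _ := rfl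

/-- the inclusion `σ : C → B = C ⋉ E` as a ring hom. -/
def tszeInl : C →+* TrivSqZeroExt C E where
  toFun := TrivSqZeroExt.inl
  map_one' := rfl
  map_mul' x y := TrivSqZeroExt.inl_mul (M := E) x y
  map_zero' := TrivSqZeroExt.inl_zero (M := E)
  map_add' x y := TrivSqZeroExt.inl_add (M := E) x y

/-- a right `C`-module viewed as a module over the trivial extension `C ⋉ E`. -/
def modB (M : Mdl Cᵐᵒᵖ) : Mdl (TrivSqZeroExt C E)ᵐᵒᵖ :=
  modAlong (tszeFst C E) M

/-- `X = M ⊗_C B` for `B = C ⋉ E`. -/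
def IsInduced (M : Mdl Cᵐᵒᵖ) (X : Mdl (TrivSqZeroExt C E)ᵐᵒᵖ) : Prop :=
  IsInducedAlong (tszeInl C E) M X

/-- `X = D(B ⊗_C D M)` for `B = C ⋉ E`. -/
def IsCoinduced (M : Mdl Cᵐᵒᵖ) (X : Mdl (TrivSqZeroExt C E)ᵐᵒᵖ) : Prop :=
  IsCoinducedAlong (tszeInl C E) M X

end TrivExt

section RelExt

variable (k : Type) [Field k] (C : Type) [Ring C] [Algebra k C]
  (E : Type) [AddCommGroup E] [Module C E] [Module Cᵐᵒᵖ E]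

/-- The `C`-`C`-bimodule `E` is `Ext²_C(DC, C)`: there is a projective
resolution `0 → P2 → P1 → P0 → DC → 0` of the right module `DC = Hom_k(C,k)`
(characterized by a nondegenerate balanced pairing `φ` with `C`), and `E` is
the cokernel of `Hom_C(P1, C) → Hom_C(P2, C)` as a left `C`-module, with the
right `C`-action on `E` induced (contravariantly, via lifts of the left action
on `DC`) by functoriality of `Ext²(-, C)`. -/
def IsRelExt : Prop :=
  ∃ (DC : Mdl Cᵐᵒᵖ) (φ : DC → C → k),
    (∀ n n' m, φ (n + n') m = φ n m + φ n' m) ∧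
    (∀ n m m', φ n (m + m') = φ n m + φ n m') ∧
    (∀ (c : k) n m, φ n ((algebraMap k C c) * m) = c * φ n m) ∧
    (∀ (a : C) n m, φ (op a • n) m = φ n (a * m)) ∧
    (∀ n, (∀ m, φ n m = 0) → n = 0) ∧
    (∀ m, (∀ n, φ n m = 0) → m = 0) ∧
    ∃ (P2 P1 P0 : Mdl Cᵐᵒᵖ) (d2 : P2 →ₗ[Cᵐᵒᵖ] P1) (d1 : P1 →ₗ[Cᵐᵒᵖ] P0)
      (d0 : P0 →ₗ[Cᵐᵒᵖ] DC),
      Module.Projective Cᵐᵒᵖ P2 ∧ Module.Projective Cᵐᵒᵖ P1 ∧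
      Module.Projective Cᵐᵒᵖ P0 ∧
      Function.Injective d2 ∧ Function.Surjective d0 ∧
      LinearMap.range d2 = LinearMap.ker d1 ∧
      LinearMap.range d1 = LinearMap.ker d0 ∧
      ∃ q : (P2 →ₗ[Cᵐᵒᵖ] C) →ₗ[C] E,
        Function.Surjective q ∧
        (∀ g : P2 →ₗ[Cᵐᵒᵖ] C, q g = 0 ↔ ∃ f : P1 →ₗ[Cᵐᵒᵖ] C, g = f.comp d2) ∧
        ∀ c : C, ∃ (μ : DC →ₗ[Cᵐᵒᵖ] DC) (f0 : P0 →ₗ[Cᵐᵒᵖ] P0)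
            (f1 : P1 →ₗ[Cᵐᵒᵖ] P1) (f2 : P2 →ₗ[Cᵐᵒᵖ] P2),
          (∀ n x, φ (μ n) x = φ n (x * c)) ∧
          d0.comp f0 = μ.comp d0 ∧
          d1.comp f1 = f0.comp d1 ∧
          d2.comp f2 = f1.comp d2 ∧
          ∀ g : P2 →ₗ[Cᵐᵒᵖ] C, q (g.comp f2) = op c • q g

end RelExt



/-! ### Generic lemmas over a ring -/

namespace TB

section Gen

variable {R : Type} [Ring R]

/-- Descend a linear map along a surjection. -/
lemma descend {A Z X : Type} [AddCommGroup A] [Module R A] [AddCommGroup Z] [Module R Z]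
    [AddCommGroup X] [Module R X] (s : A →ₗ[R] Z) (hs : Function.Surjective s)
    (t : A →ₗ[R] X) (h : ∀ a, s a = 0 → t a = 0) : ∃ u : Z →ₗ[R] X, ∀ a, u (s a) = t a := by
  have hk : LinearMap.ker s ≤ LinearMap.ker t := fun a ha => h a ha
  refine ⟨((LinearMap.ker s).liftQ t hk).comp
    (s.quotKerEquivOfSurjective hs).symm.toLinearMap, fun a => ?_⟩
  have : (s.quotKerEquivOfSurjective hs).symm (s a) = Submodule.Quotient.mk a := by
    rw [LinearEquiv.symm_apply_eq]; rfl
  simp [this]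

/-- Glue two maps on a sum of images. -/
lemma glue {A B Z X : Type} [AddCommGroup A] [Module R A] [AddCommGroup B] [Module R B]
    [AddCommGroup Z] [Module R Z] [AddCommGroup X] [Module R X]
    (α : A →ₗ[R] Z) (β : B →ₗ[R] Z) (hs : ∀ z, ∃ a b, α a + β b = z)
    (a : A →ₗ[R] X) (b : B →ₗ[R] X) (h : ∀ x y, α x + β y = 0 → a x + b y = 0) :
    ∃ u : Z →ₗ[R] X, (∀ x, u (α x) = a x) ∧ ∀ y, u (β y) = b y := by
  obtain ⟨u, hu⟩ := descend (α.coprod β)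
    (fun z => by obtain ⟨x, y, h⟩ := hs z; exact ⟨(x, y), by simpa using h⟩)
    (a.coprod b) (fun x hx => by simpa using h x.1 x.2 (by simpa using hx))
  refine ⟨u, fun x => ?_, fun y => ?_⟩
  · simpa using hu (x, 0)
  · simpa using hu (0, y)

/-- Restrict the codomain along an injection with controlled range. -/
lemma corestrict {A Z X : Type} [AddCommGroup A] [Module R A] [AddCommGroup Z] [Module R Z]
    [AddCommGroup X] [Module R X] (i : X →ₗ[R] Z) (hi : Function.Injective i)
    (t : A →ₗ[R] Z) (h : ∀ a, ∃ x, i x = t a) : ∃ u : A →ₗ[R] X, ∀ a, i (u a) = t a := by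
  refine ⟨(LinearEquiv.ofInjective i hi).symm.toLinearMap.comp
    (t.codRestrict (LinearMap.range i) (fun a => h a)), fun a => ?_⟩
  exact LinearEquiv.ofInjective_symm_apply (f := i) (h := hi)
    (t.codRestrict (LinearMap.range i) (fun a => h a) a)

/-- Lift a map from a projective module through an exact pair. -/
lemma lift_exact {A X Y Z : Type} [AddCommGroup A] [Module R A] [AddCommGroup Z] [Module R Z]
    [AddCommGroup X] [Module R X] [AddCommGroup Y] [Module R Y] [Module.Projective R A]
    (p : X →ₗ[R] Y) (π : Y →ₗ[R] Z) (hex : ∀ y, π y = 0 → ∃ x, p x = y)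
    (t : A →ₗ[R] Y) (h : ∀ a, π (t a) = 0) : ∃ u : A →ₗ[R] X, ∀ a, p (u a) = t a := by
  obtain ⟨u, hu⟩ := Module.projective_lifting_property p.rangeRestrict
    (t.codRestrict (LinearMap.range p) (fun a => hex _ (h a))) p.surjective_rangeRestrict
  refine ⟨u, fun a => ?_⟩
  exact congrArg (fun v => (v a : Y)) hu

lemma lift_surj {A X Y : Type} [AddCommGroup A] [Module R A]
    [AddCommGroup X] [Module R X] [AddCommGroup Y] [Module R Y] [Module.Projective R A]
    (p : X →ₗ[R] Y) (hp : Function.Surjective p)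
    (t : A →ₗ[R] Y) : ∃ u : A →ₗ[R] X, ∀ a, p (u a) = t a := by
  obtain ⟨u, hu⟩ := Module.projective_lifting_property p t hp
  exact ⟨u, fun a => LinearMap.congr_fun hu a⟩

/-- Extend a map into an injective module along an exact pair. -/
lemma ext_exact {A B I : Type} [AddCommGroup A] [Module R A] [AddCommGroup B] [Module R B]
    [AddCommGroup I] [Module R I] [Module.Injective R I]
    (e : A →ₗ[R] B) (t : A →ₗ[R] I) (h : ∀ a, e a = 0 → t a = 0) :
    ∃ u : B →ₗ[R] I, ∀ a, u (e a) = t a := by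
  obtain ⟨v, hv⟩ := descend e.rangeRestrict e.surjective_rangeRestrict t
    (fun a ha => h a (by simpa using congrArg Subtype.val ha))
  obtain ⟨u, hu⟩ := Module.Injective.out (LinearMap.range e).subtype
    (Submodule.subtype_injective _) v
  exact ⟨u, fun a => by simpa [hv] using hu (e.rangeRestrict a)⟩

/-- finite dual basis -/
lemma dualBasis (P : Type) [AddCommGroup P] [Module R P] [Module.Finite R P]
    [Module.Projective R P] :
    ∃ (n : ℕ) (g : Fin n → (P →ₗ[R] R)) (x : Fin n → P), ∀ y, ∑ i, g i y • x i = y := by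
  obtain ⟨n, f, g, -, -, h⟩ := Module.Finite.exists_comp_eq_id_of_projective R P
  refine ⟨n, fun i => (LinearMap.proj i).comp g, fun i => f (Pi.single i 1), fun y => ?_⟩
  have h1 := LinearMap.congr_fun h y
  simp only [LinearMap.comp_apply, LinearMap.id_apply] at h1
  conv_rhs => rw [← h1, pi_eq_sum_univ' (g y)]
  simp only [map_sum, map_smul, LinearMap.comp_apply, LinearMap.proj_apply]

lemma finite_of_superfluous {P M : Type} [AddCommGroup P] [Module R P] [AddCommGroup M]
    [Module R M] [Module.Finite R M] (f : P →ₗ[R] M) (hf : Function.Surjective f)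
    (hs : ∀ N : Submodule R P, N ⊔ LinearMap.ker f = ⊤ → N = ⊤) : Module.Finite R P := by
  obtain ⟨n, s, hsp⟩ := Module.Finite.exists_fin (R := R) (M := M)
  choose t ht using fun i => hf (s i)
  have : Submodule.span R (Set.range t) = ⊤ := by
    apply hs
    rw [eq_top_iff]
    intro y _
    have hy : f y ∈ Submodule.map f (Submodule.span R (Set.range t)) := by
      rw [Submodule.map_span, ← Set.range_comp]
      have : (f ∘ t) = s := funext ht
      rw [this, hsp]; trivial
    obtain ⟨z, hz, hzy⟩ := hy
    have : y = z + (y - z) := by abel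
    rw [this]
    exact Submodule.add_mem_sup hz (by simp [hzy])
  exact Module.Finite.of_fg_top (this ▸ Submodule.fg_span (Set.finite_range t))

lemma proj_of_isCompl {P : Type} [AddCommGroup P] [Module R P] [Module.Projective R P]
    {U V : Submodule R P} (h : IsCompl U V) : Module.Projective R U :=
  Module.Projective.of_split U.subtype (U.projectionOnto V h)
    (Submodule.projectionOnto_comp_subtype h)

lemma inj_of_retract {I J : Type} [AddCommGroup I] [Module R I] [AddCommGroup J] [Module R J]
    [Module.Injective R I] (i : J →ₗ[R] I) (r : I →ₗ[R] J) (h : ∀ x, r (i x) = x) :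
    Module.Injective R J := by
  constructor
  intro X Y _ _ _ _ f hf g
  obtain ⟨u, hu⟩ := Module.Injective.out f hf (i.comp g)
  exact ⟨r.comp u, fun x => by simp [hu, h]⟩

/-- existence of projective covers over artinian rings -/
lemma exists_cover [IsArtinianRing R] (N : Type) [AddCommGroup N] [Module R N]
    [Module.Finite R N] :
    ∃ (P : Mdl R) (f : P →ₗ[R] N), Module.Finite R P ∧ Module.Projective R P ∧
      Function.Surjective f ∧ ∀ U : Submodule R P, U ⊔ LinearMap.ker f = ⊤ → U = ⊤ := by
  obtain ⟨n, f, hf⟩ := Module.Finite.exists_fin' R N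
  let S : Set (Submodule R (Fin n → R)) :=
    {U | Module.Projective R U ∧ Function.Surjective (f.comp U.subtype)}
  obtain ⟨U, ⟨hUp, hUs⟩, hmin⟩ := IsArtinian.set_has_minimal S
    ⟨⊤, Module.Projective.of_equiv (Submodule.topEquiv (R := R) (M := Fin n → R)).symm,
      fun y => by obtain ⟨x, hx⟩ := hf y; exact ⟨⟨x, trivial⟩, hx⟩⟩
  suffices key : ∀ L : Submodule R U, L ⊔ LinearMap.ker (f.comp U.subtype) = ⊤ → L = ⊤ from
    ⟨ModuleCat.of R U, f.comp U.subtype, inferInstanceAs (Module.Finite R U), hUp, hUs, key⟩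
  intro L hL
  have hLs : Function.Surjective ((f.comp U.subtype).comp L.subtype) := by
    intro y
    obtain ⟨x, hx⟩ := hUs y
    have : x ∈ L ⊔ LinearMap.ker (f.comp U.subtype) := by
      rw [hL]; trivial
    obtain ⟨a, ha, b, hb, rfl⟩ := Submodule.mem_sup.1 this
    refine ⟨⟨a, ha⟩, ?_⟩
    rw [← hx, map_add, LinearMap.mem_ker.1 hb, add_zero]; rfl
  obtain ⟨s', hs'⟩ := lift_surj (R := R) (A := U) (X := L) (Y := N) ((f.comp U.subtype).comp L.subtype) hLs
    (f.comp U.subtype)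
  let s : Module.End R U := L.subtype.comp s'
  have hs : ∀ x, f (s x) = f x := hs'
  have hsn : ∀ (m : ℕ) x, f ((s ^ m) x : U) = f (x : U) := by
    intro m
    induction m with
    | zero => intro x; simp
    | succ m ih => intro x; rw [pow_succ, Module.End.mul_apply, ih, hs]
  obtain ⟨m, hm, hc⟩ := ((Filter.eventually_ge_atTop 1).and
    (LinearMap.eventually_isCompl_ker_pow_range_pow s)).exists
  have hproj := proj_of_isCompl hc.symm
  have htop : LinearMap.range (s ^ m) = ⊤ := by
    have hmem : (LinearMap.range (s ^ m)).map U.subtype ∈ S := by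
      refine ⟨Module.Projective.of_equiv
        (Submodule.equivMapOfInjective U.subtype (Submodule.subtype_injective _) _), ?_⟩
      intro y
      obtain ⟨x, hx⟩ := hUs y
      exact ⟨⟨((s ^ m) x : U), Submodule.mem_map_of_mem (f := U.subtype) ⟨x, rfl⟩⟩,
        (hsn m x).trans hx⟩
    have h1 := hmin _ hmem
    have h2 : (LinearMap.range (s ^ m)).map U.subtype = U := by
      have hle := Submodule.map_subtype_le U (LinearMap.range (s ^ m))
      by_contra hne
      exact h1 (lt_of_le_of_ne hle hne)
    rw [eq_top_iff]
    intro x _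
    have : (x : Fin n → R) ∈ (LinearMap.range (s ^ m)).map U.subtype := by rw [h2]; exact x.2
    obtain ⟨z, hz, hzx⟩ := this
    have : z = x := Subtype.ext hzx
    exact this ▸ hz
  rw [eq_top_iff]
  intro x _
  have : x ∈ LinearMap.range (s ^ m) := by rw [htop]; trivial
  obtain ⟨z, rfl⟩ := this
  obtain ⟨j, rfl⟩ : ∃ j, m = j + 1 := ⟨m - 1, by omega⟩
  rw [pow_succ', Module.End.mul_apply]
  exact (s' _).2

/-- an embedding in a finite length injective module can be cut down to an envelope -/
lemma exists_env {P I : Type} [AddCommGroup P] [Module R P] [AddCommGroup I] [Module R I]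
    [IsArtinian R I] [IsNoetherian R I] [Module.Injective R I] (f : P →ₗ[R] I)
    (hf : Function.Injective f) :
    ∃ (J : Mdl R) (g : P →ₗ[R] J), Module.Finite R J ∧ Module.Injective R J ∧
      Function.Injective g ∧ ∀ K : Submodule R J, K ⊓ LinearMap.range g = ⊥ → K = ⊥ := by
  let S : Set (Submodule R I) := {U | Module.Injective R U ∧ LinearMap.range f ≤ U}
  obtain ⟨U, ⟨hUi, hUf⟩, hmin⟩ := IsArtinian.set_has_minimal S
    ⟨⊤, inj_of_retract (⊤ : Submodule R I).subtype
      (Submodule.topEquiv (R := R) (M := I)).symm.toLinearMap (fun x => rfl), le_top⟩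
  let g : P →ₗ[R] U := f.codRestrict U (fun x => hUf ⟨x, rfl⟩)
  have hg : Function.Injective g := fun x y h => hf (congrArg Subtype.val h)
  refine ⟨ModuleCat.of R U, g, inferInstanceAs (Module.Finite R U), hUi, hg, ?_⟩
  intro K hK
  change Submodule R U at K
  change K = ⊥
  have hKi : ∀ x, K.mkQ (g x) = 0 → g x = 0 := by
    intro x hx
    have h1 : g x ∈ K := by simpa using hx
    have : g x ∈ K ⊓ LinearMap.range g := ⟨h1, x, rfl⟩
    rw [show K ⊓ LinearMap.range g = ⊥ from hK] at this
    simpa using this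
  obtain ⟨t, ht⟩ := ext_exact (K.mkQ.comp g) g hKi
  let s : Module.End R U := t.comp K.mkQ
  have hs : ∀ x, s (g x) = g x := ht
  have hsn : ∀ (m : ℕ) x, (s ^ m) (g x) = g x := by
    intro m
    induction m with
    | zero => intro x; simp
    | succ m ih => intro x; rw [pow_succ, Module.End.mul_apply, hs, ih]
  obtain ⟨m, hm, hc⟩ := ((Filter.eventually_ge_atTop 1).and
    (LinearMap.eventually_isCompl_ker_pow_range_pow s)).exists
  have hker : LinearMap.ker (s ^ m) = ⊥ := by
    have hmem : (LinearMap.range (s ^ m)).map U.subtype ∈ S := by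
      refine ⟨?_, ?_⟩
      · have hri : Module.Injective R (LinearMap.range (s ^ m)) :=
          inj_of_retract (LinearMap.range (s ^ m)).subtype
            ((LinearMap.range (s ^ m)).projectionOnto _ hc.symm)
            (fun x => LinearMap.congr_fun (Submodule.projectionOnto_comp_subtype hc.symm) x)
        let e := Submodule.equivMapOfInjective U.subtype (Submodule.subtype_injective _)
          (LinearMap.range (s ^ m))
        exact inj_of_retract e.symm.toLinearMap e.toLinearMap (fun x => e.apply_symm_apply x)
      · rintro _ ⟨x, rfl⟩
        exact ⟨g x, ⟨g x, hsn m x⟩, rfl⟩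
    have h1 := hmin _ hmem
    have h2 : (LinearMap.range (s ^ m)).map U.subtype = U := by
      have hle := Submodule.map_subtype_le U (LinearMap.range (s ^ m))
      by_contra hne
      exact h1 (lt_of_le_of_ne hle hne)
    have htop : LinearMap.range (s ^ m) = ⊤ := by
      rw [eq_top_iff]
      intro x _
      have : (x : I) ∈ (LinearMap.range (s ^ m)).map U.subtype := by rw [h2]; exact x.2
      obtain ⟨z, hz, hzx⟩ := this
      have : z = x := Subtype.ext hzx
      exact this ▸ hz
    have := hc.inf_eq_bot
    rwa [htop, inf_top_eq] at this
  rw [eq_bot_iff]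
  intro x hx
  rw [← hker]
  obtain ⟨j, rfl⟩ : ∃ j, m = j + 1 := ⟨m - 1, by omega⟩
  have : s x = 0 := by
    change t (K.mkQ x) = 0
    rw [(Submodule.Quotient.mk_eq_zero K).2 hx |> fun h => (h : K.mkQ x = 0), map_zero]
  rw [LinearMap.mem_ker, pow_succ, Module.End.mul_apply, this, map_zero]

end Gen


section Chains

variable {R : Type} [Ring R]

lemma inj_I2 {I0 I1 I2 : Type} [AddCommGroup I0] [Module R I0] [AddCommGroup I1] [Module R I1]
    [AddCommGroup I2] [Module R I2] (hgl : GlDimLE2 R) [Module.Injective R I0]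
    [Module.Injective R I1] (p : I0 →ₗ[R] I1) (π : I1 →ₗ[R] I2) (hp : ∀ x, π (p x) = 0)
    (hex : ∀ y, π y = 0 → ∃ x, p x = y) (hπ : Function.Surjective π) :
    Module.Injective R I2 := by
  constructor
  intro Y' Y _ _ _ _ f hf a
  obtain ⟨S2, S1, S0, s2, s1, s0, hS2, hS1, hS0, hs2, hs0, h21, h10⟩ :=
    hgl (ModuleCat.of R (Y ⧸ LinearMap.range f))
  have h21' : ∀ x, s1 (s2 x) = 0 := fun x => by
    have : s2 x ∈ LinearMap.ker s1 := h21 ▸ ⟨x, rfl⟩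
    exact this
  have h10' : ∀ x, s0 (s1 x) = 0 := fun x => by
    have : s1 x ∈ LinearMap.ker s0 := h10 ▸ ⟨x, rfl⟩
    exact this
  have h21e : ∀ y, s1 y = 0 → ∃ x, s2 x = y := fun y hy => by
    have : y ∈ LinearMap.range s2 := h21 ▸ hy
    exact this
  have h10e : ∀ y, s0 y = 0 → ∃ x, s1 x = y := fun y hy => by
    have : y ∈ LinearMap.range s1 := h10 ▸ hy
    exact this
  obtain ⟨t0, ht0⟩ := lift_surj (LinearMap.range f).mkQ (Submodule.mkQ_surjective _)
    (s0 : S0 →ₗ[R] (Y ⧸ LinearMap.range f))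
  obtain ⟨t1, ht1⟩ := corestrict f hf (t0.comp s1) (fun z => by
    have : (LinearMap.range f).mkQ (t0 (s1 z)) = 0 := (ht0 _).trans (h10' z)
    have : t0 (s1 z) ∈ LinearMap.range f := by simpa using this
    exact this)
  have ht12 : ∀ x, t1 (s2 x) = 0 := fun x => hf (by simp [ht1, h21'])
  obtain ⟨b1, hb1⟩ := lift_surj π hπ (a.comp t1)
  obtain ⟨b2, hb2⟩ := lift_exact p π hex (b1.comp s2) (fun x => by simp [hb1, ht12])
  obtain ⟨b2', hb2'⟩ := Module.Injective.out s2 hs2 b2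
  obtain ⟨c0, hc0⟩ := ext_exact s1 (b1 - p.comp b2') (fun z hz => by
    obtain ⟨x, rfl⟩ := h21e z hz
    simp [hb2', hb2])
  obtain ⟨u, -, hu⟩ := glue t0 f (fun y => by
      obtain ⟨z, hz⟩ := hs0 ((LinearMap.range f).mkQ y)
      have h1 : (LinearMap.range f).mkQ (y - t0 z) = 0 := by
        rw [map_sub, ht0, hz, sub_self]
      have h2 : y - t0 z ∈ LinearMap.range f := (Submodule.Quotient.mk_eq_zero _).1 h1
      obtain ⟨y', hy'⟩ := h2
      exact ⟨z, y', by rw [hy']; abel⟩)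
    (π.comp c0) a (fun z y h => by
      have hz : s0 z = 0 := by
        rw [← ht0, show t0 z = f (-y) by rw [map_neg]; exact eq_neg_of_add_eq_zero_left h]
        simp
      obtain ⟨z1, rfl⟩ := h10e z hz
      have : y = - t1 z1 := hf (by
        rw [map_neg, ht1]; exact eq_neg_of_add_eq_zero_right h)
      simp [hc0, hb1, hp, this])
  exact ⟨u, hu⟩

lemma lift_pd1 {I0 I1 I2 : Type} [AddCommGroup I0] [Module R I0] [AddCommGroup I1] [Module R I1]
    [AddCommGroup I2] [Module R I2] [Module.Injective R I0]
    (p : I0 →ₗ[R] I1) (π : I1 →ₗ[R] I2) (hp : ∀ x, π (p x) = 0)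
    (hex : ∀ y, π y = 0 → ∃ x, p x = y) (hπ : Function.Surjective π)
    (X : Mdl R) (hX : PdLE1 R X) (a : X →ₗ[R] I2) :
    ∃ v : X →ₗ[R] I1, ∀ x, π (v x) = a x := by
  obtain ⟨S1, S0, s1, s0, hS1, hS0, hs1, hs0, h10⟩ := hX
  have h10' : ∀ x, s0 (s1 x) = 0 := fun x => by
    have : s1 x ∈ LinearMap.ker s0 := h10 ▸ ⟨x, rfl⟩
    exact this
  have h10e : ∀ y, s0 y = 0 → ∃ x, s1 x = y := fun y hy => by
    have : y ∈ LinearMap.range s1 := h10 ▸ hy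
    exact this
  obtain ⟨b0, hb0⟩ := lift_surj π hπ (a.comp s0)
  obtain ⟨b1, hb1⟩ := lift_exact p π hex (b0.comp s1) (fun x => by simp [hb0, h10'])
  obtain ⟨b1', hb1'⟩ := Module.Injective.out s1 hs1 b1
  obtain ⟨v, hv⟩ := descend s0 hs0 (b0 - p.comp b1') (fun z hz => by
    obtain ⟨x, rfl⟩ := h10e z hz
    simp [hb1', hb1])
  refine ⟨v, fun x => ?_⟩
  obtain ⟨z, rfl⟩ := hs0 x
  simp [hv, hb0, hp]

/-- A projective resolution `R2 → R1 → R0 → DC` and an injective one `P → I0 → I1 → I2`. -/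
structure Setup (R : Type) [Ring R] (P I0 I1 I2 R2 R1 R0 DC : Type)
    [AddCommGroup P] [Module R P] [AddCommGroup I0] [Module R I0]
    [AddCommGroup I1] [Module R I1] [AddCommGroup I2] [Module R I2]
    [AddCommGroup R2] [Module R R2] [AddCommGroup R1] [Module R R1]
    [AddCommGroup R0] [Module R R0] [AddCommGroup DC] [Module R DC] where
  ι : P →ₗ[R] I0
  p : I0 →ₗ[R] I1
  π : I1 →ₗ[R] I2
  e2 : R2 →ₗ[R] R1
  e1 : R1 →ₗ[R] R0
  e0 : R0 →ₗ[R] DC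
  hI0 : Module.Injective R I0
  hI1 : Module.Injective R I1
  hR1 : Module.Projective R R1
  hR0 : Module.Projective R R0
  ι_inj : Function.Injective ι
  pι : ∀ x, p (ι x) = 0
  p_ex : ∀ y, p y = 0 → ∃ x, ι x = y
  πp : ∀ x, π (p x) = 0
  π_ex : ∀ y, π y = 0 → ∃ x, p x = y
  π_surj : Function.Surjective π
  e2_inj : Function.Injective e2
  e12 : ∀ x, e1 (e2 x) = 0
  e1_ex : ∀ y, e1 y = 0 → ∃ x, e2 x = y
  e01 : ∀ x, e0 (e1 x) = 0
  e0_ex : ∀ y, e0 y = 0 → ∃ x, e1 x = y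
  e0_surj : Function.Surjective e0

namespace Setup

variable {P I0 I1 I2 R2 R1 R0 DC : Type}
    [AddCommGroup P] [Module R P] [AddCommGroup I0] [Module R I0]
    [AddCommGroup I1] [Module R I1] [AddCommGroup I2] [Module R I2]
    [AddCommGroup R2] [Module R R2] [AddCommGroup R1] [Module R R1]
    [AddCommGroup R0] [Module R R0] [AddCommGroup DC] [Module R DC]
    (S : Setup R P I0 I1 I2 R2 R1 R0 DC)

/-- `w` represents the image of `u` under the connecting map. -/
def Chain (u : DC →ₗ[R] I2) (w : R2 →ₗ[R] P) : Prop :=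
  ∃ (u0 : R0 →ₗ[R] I1) (u1 : R1 →ₗ[R] I0), (∀ x, S.π (u0 x) = u (S.e0 x)) ∧
    (∀ x, S.p (u1 x) = u0 (S.e1 x)) ∧ ∀ x, S.ι (w x) = u1 (S.e2 x)

lemma chain_exists (u : DC →ₗ[R] I2) : ∃ w, S.Chain u w := by
  have := S.hR1
  have := S.hR0
  obtain ⟨u0, h0⟩ := lift_surj S.π S.π_surj (u.comp S.e0)
  obtain ⟨u1, h1⟩ := lift_exact S.p S.π S.π_ex (u0.comp S.e1)
    (fun x => by simp [h0, S.e01])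
  obtain ⟨w, hw⟩ := corestrict S.ι S.ι_inj (u1.comp S.e2)
    (fun x => S.p_ex _ (by simp [h1, S.e12]))
  exact ⟨w, u0, u1, h0, h1, hw⟩

lemma chain_surj (w : R2 →ₗ[R] P) : ∃ u, S.Chain u w := by
  have := S.hI0
  have := S.hI1
  obtain ⟨u1, h1⟩ := Module.Injective.out S.e2 S.e2_inj (S.ι.comp w)
  obtain ⟨u0, h0⟩ := ext_exact S.e1 (S.p.comp u1) (fun z hz => by
    obtain ⟨x, rfl⟩ := S.e1_ex z hz
    simp [h1, S.pι])
  obtain ⟨u, hu⟩ := descend S.e0 S.e0_surj (S.π.comp u0) (fun z hz => by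
    obtain ⟨x, rfl⟩ := S.e0_ex z hz
    simp [h0, S.πp])
  exact ⟨u, u0, u1, fun x => (hu x).symm, fun x => (h0 x).symm, fun x => (h1 x).symm⟩

lemma chain_add {u u' : DC →ₗ[R] I2} {w w' : R2 →ₗ[R] P} (h : S.Chain u w)
    (h' : S.Chain u' w') : S.Chain (u + u') (w + w') := by
  obtain ⟨u0, u1, a, b, c⟩ := h
  obtain ⟨u0', u1', a', b', c'⟩ := h'
  exact ⟨u0 + u0', u1 + u1', fun x => by simp [a, a'], fun x => by simp [b, b'],
    fun x => by simp [c, c']⟩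

lemma chain_neg {u : DC →ₗ[R] I2} {w : R2 →ₗ[R] P} (h : S.Chain u w) :
    S.Chain (-u) (-w) := by
  obtain ⟨u0, u1, a, b, c⟩ := h
  exact ⟨-u0, -u1, fun x => by simp [a], fun x => by simp [b], fun x => by simp [c]⟩

lemma chain_comp {u : DC →ₗ[R] I2} {w : R2 →ₗ[R] P} (h : S.Chain u w)
    (μ : DC →ₗ[R] DC) (f0 : R0 →ₗ[R] R0) (f1 : R1 →ₗ[R] R1) (f2 : R2 →ₗ[R] R2)
    (h0 : S.e0.comp f0 = μ.comp S.e0) (h1 : S.e1.comp f1 = f0.comp S.e1)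
    (h2 : S.e2.comp f2 = f1.comp S.e2) : S.Chain (u.comp μ) (w.comp f2) := by
  obtain ⟨u0, u1, a, b, c⟩ := h
  refine ⟨u0.comp f0, u1.comp f1, fun x => ?_, fun x => ?_, fun x => ?_⟩
  · have := LinearMap.congr_fun h0 x
    simp only [LinearMap.comp_apply] at this ⊢
    rw [a, this]
  · have := LinearMap.congr_fun h1 x
    simp only [LinearMap.comp_apply] at this ⊢
    rw [b, this]
  · have := LinearMap.congr_fun h2 x
    simp only [LinearMap.comp_apply] at this ⊢
    rw [c, this]

lemma chain_zero (v : DC →ₗ[R] I1) {u : DC →ₗ[R] I2} (huv : ∀ x, S.π (v x) = u x)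
    {w : R2 →ₗ[R] P} (h : S.Chain u w) : ∃ t : R1 →ₗ[R] P, w = t.comp S.e2 := by
  obtain ⟨u0, u1, a, b, c⟩ := h
  have := S.hR0
  obtain ⟨t0, ht0⟩ := lift_exact S.p S.π S.π_ex (u0 - v.comp S.e0)
    (fun x => by simp [a, huv])
  obtain ⟨t1, ht1⟩ := corestrict S.ι S.ι_inj (u1 - t0.comp S.e1) (fun x => S.p_ex _ (by
    simp [b, ht0, S.e01]))
  refine ⟨t1, ?_⟩
  ext x
  apply S.ι_inj
  simp [ht1, c, S.e12]

end Setup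

end Chains


set_option linter.style.haveILetI false

section Duals

variable (k : Type) [Field k] (C : Type) [Ring C] [Algebra k C]

/-- the `k`-structure on a module over a `k`-algebra -/
abbrev kmod (A : Type) [Ring A] [Algebra k A] (M : Type) [AddCommGroup M] [Module A M] :
    Module k M := Module.compHom M (algebraMap k A)

lemma ktower (A : Type) [Ring A] [Algebra k A] (M : Type) [AddCommGroup M] [Module A M] :
    letI := kmod k A M
    IsScalarTower k A M := by
  letI := kmod k A M
  constructor
  intro c a m
  rw [Algebra.smul_def, mul_smul]; rfl

/-- functionals on a module over a `k`-algebra -/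
def Fnl (A : Type) [Ring A] [Algebra k A] (M : Type) [AddCommGroup M] [Module A M] :
    AddSubgroup (M → k) where
  carrier := {f | (∀ x y, f (x + y) = f x + f y) ∧ ∀ (c : k) x, f (algebraMap k A c • x) = c * f x}
  add_mem' := by
    rintro f g ⟨h1, h2⟩ ⟨h3, h4⟩
    refine ⟨fun x y => ?_, fun c x => ?_⟩
    · simp only [Pi.add_apply, h1, h3]; abel
    · simp only [Pi.add_apply, h2, h4]; ring
  zero_mem' := ⟨fun x y => by simp, fun c x => by simp⟩
  neg_mem' := by
    rintro f ⟨h1, h2⟩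
    refine ⟨fun x y => ?_, fun c x => ?_⟩
    · simp only [Pi.neg_apply, h1]; abel
    · simp only [Pi.neg_apply, h2]; ring

/-- the dual of a left module, as a right module -/
def DL (Q : Type) [AddCommGroup Q] [Module C Q] : Type := ↥(Fnl k C Q)

/-- the dual of a right module, as a left module -/
def DR (V : Type) [AddCommGroup V] [Module Cᵐᵒᵖ V] : Type := ↥(Fnl k Cᵐᵒᵖ V)

section
variable (Q : Type) [AddCommGroup Q] [Module C Q]

noncomputable instance : AddCommGroup (DL k C Q) :=
  inferInstanceAs (AddCommGroup ↥(Fnl k C Q))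

instance : FunLike (DL k C Q) Q k where
  coe f := f.1
  coe_injective _ _ h := Subtype.ext h

instance : AddMonoidHomClass (DL k C Q) Q k where
  map_add f := f.2.1
  map_zero f := by
    have := f.2.1 0 0
    rw [add_zero] at this
    exact left_eq_add.1 this

variable {Q}

@[ext] lemma DL.ext {f g : DL k C Q} (h : ∀ x, f x = g x) : f = g := DFunLike.ext _ _ h

lemma DL.add_apply (f g : DL k C Q) (x : Q) : (f + g) x = f x + g x := rfl

lemma DL.zero_apply (x : Q) : (0 : DL k C Q) x = 0 := rfl

lemma DL.map_k (f : DL k C Q) (c : k) (x : Q) : f (algebraMap k C c • x) = c * f x := f.2.2 c x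

/-- constructor -/
def DL.mk' (f : Q → k) (h1 : ∀ x y, f (x + y) = f x + f y)
    (h2 : ∀ c x, f (algebraMap k C c • x) = c * f x) : DL k C Q := ⟨f, h1, h2⟩

@[simp] lemma DL.mk'_apply (f : Q → k) (h1 h2) (x : Q) : DL.mk' k C f h1 h2 x = f x := rfl

noncomputable instance : Module Cᵐᵒᵖ (DL k C Q) where
  smul a f := DL.mk' k C (fun x => f (unop a • x)) (fun x y => by rw [smul_add, map_add])
    (fun c x => by rw [← DL.map_k, ← mul_smul, ← mul_smul, Algebra.commutes])
  one_smul f := by ext x; change f ((1 : C) • x) = f x; rw [one_smul]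
  mul_smul a b f := by
    ext x; change f ((unop b * unop a) • x) = f (unop b • unop a • x); rw [mul_smul]
  smul_zero a := rfl
  smul_add a f g := rfl
  add_smul a b f := by
    ext x; change f ((unop a + unop b) • x) = f (unop a • x) + f (unop b • x)
    rw [add_smul, map_add]
  zero_smul f := by ext x; change f ((0 : C) • x) = 0; rw [zero_smul, map_zero]

lemma DL.smul_apply (a : Cᵐᵒᵖ) (f : DL k C Q) (x : Q) : (a • f) x = f (unop a • x) := rfl

end

section
variable (V : Type) [AddCommGroup V] [Module Cᵐᵒᵖ V]

noncomputable instance : AddCommGroup (DR k C V) :=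
  inferInstanceAs (AddCommGroup ↥(Fnl k Cᵐᵒᵖ V))

instance : FunLike (DR k C V) V k where
  coe f := f.1
  coe_injective _ _ h := Subtype.ext h

instance : AddMonoidHomClass (DR k C V) V k where
  map_add f := f.2.1
  map_zero f := by
    have := f.2.1 0 0
    rw [add_zero] at this
    exact left_eq_add.1 this

variable {V}

@[ext] lemma DR.ext {f g : DR k C V} (h : ∀ x, f x = g x) : f = g := DFunLike.ext _ _ h

lemma DR.add_apply (f g : DR k C V) (x : V) : (f + g) x = f x + g x := rfl

lemma DR.zero_apply (x : V) : (0 : DR k C V) x = 0 := rfl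

lemma DR.map_k (f : DR k C V) (c : k) (x : V) : f (op (algebraMap k C c) • x) = c * f x :=
  f.2.2 c x

/-- constructor -/
def DR.mk' (f : V → k) (h1 : ∀ x y, f (x + y) = f x + f y)
    (h2 : ∀ c x, f (op (algebraMap k C c) • x) = c * f x) : DR k C V := ⟨f, h1, h2⟩

@[simp] lemma DR.mk'_apply (f : V → k) (h1 h2) (x : V) : DR.mk' k C f h1 h2 x = f x := rfl

noncomputable instance : Module C (DR k C V) where
  smul a f := DR.mk' k C (fun x => f (op a • x)) (fun x y => by rw [smul_add, map_add])
    (fun c x => by rw [← DR.map_k, ← mul_smul, ← mul_smul, ← op_mul, ← op_mul,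
      Algebra.commutes])
  one_smul f := by ext x; change f ((1 : Cᵐᵒᵖ) • x) = f x; rw [one_smul]
  mul_smul a b f := by
    ext x; change f (op (a * b) • x) = f (op b • op a • x); rw [op_mul, mul_smul]
  smul_zero a := rfl
  smul_add a f g := rfl
  add_smul a b f := by
    ext x; change f (op (a + b) • x) = f (op a • x) + f (op b • x)
    rw [MulOpposite.op_add, add_smul, map_add]
  zero_smul f := by ext x; change f ((0 : Cᵐᵒᵖ) • x) = 0; rw [zero_smul, map_zero]

lemma DR.smul_apply (a : C) (f : DR k C V) (x : V) : (a • f) x = f (op a • x) := rfl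

/-- functionals separate points -/
lemma DR.sep (x : V) (h : ∀ f : DR k C V, f x = 0) : x = 0 := by
  letI := kmod k Cᵐᵒᵖ V
  refine (Module.forall_dual_apply_eq_zero_iff k x).1 (fun f => ?_)
  exact h (DR.mk' k C (fun x => f x) f.map_add (fun c x => LinearMap.map_smul f c x))

lemma DL.sep {Q : Type} [AddCommGroup Q] [Module C Q] (x : Q)
    (h : ∀ f : DL k C Q, f x = 0) : x = 0 := by
  letI := kmod k C Q
  refine (Module.forall_dual_apply_eq_zero_iff k x).1 (fun f => ?_)
  exact h (DL.mk' k C (fun x => f x) f.map_add (fun c x => LinearMap.map_smul f c x))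

/-- extension of functionals along an injection -/
lemma DR.extend {V' : Type} [AddCommGroup V'] [Module Cᵐᵒᵖ V'] (f : V →ₗ[Cᵐᵒᵖ] V')
    (hf : Function.Injective f) (ξ : DR k C V) : ∃ η : DR k C V', ∀ x, η (f x) = ξ x := by
  letI := kmod k Cᵐᵒᵖ V
  letI := kmod k Cᵐᵒᵖ V'
  let f' : V →ₗ[k] V' :=
    { toFun := f
      map_add' := f.map_add
      map_smul' := fun c x => f.map_smul (algebraMap k Cᵐᵒᵖ c) x }
  let ξ' : V →ₗ[k] k :=
    { toFun := ξ
      map_add' := ξ.2.1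
      map_smul' := ξ.2.2 }
  obtain ⟨η, hη⟩ := LinearMap.dualMap_surjective_of_injective (f := f') hf ξ'
  exact ⟨DR.mk' k C (fun x => η x) η.map_add (fun c x => LinearMap.map_smul η c x), fun x => LinearMap.congr_fun hη x⟩

/-- reflexivity -/
lemma DR.eval_surj [FiniteDimensional k C] [Module.Finite Cᵐᵒᵖ V] (F : DR k C V → k)
    (h1 : ∀ f g, F (f + g) = F f + F g)
    (h2 : ∀ (c : k) f, F (algebraMap k C c • f) = c * F f) : ∃ v, ∀ f, F f = f v := by
  letI := kmod k Cᵐᵒᵖ V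
  haveI := ktower k Cᵐᵒᵖ V
  haveI : Module.Finite k V := Module.Finite.trans Cᵐᵒᵖ V
  let F' : Module.Dual k (Module.Dual k V) :=
    { toFun := fun f => F (DR.mk' k C (fun x => f x) f.map_add (fun c x => LinearMap.map_smul f c x))
      map_add' := fun f g => by
        refine Eq.trans ?_ (h1 _ _)
        congr 1
      map_smul' := fun c f => by
        refine Eq.trans ?_ (h2 c _)
        congr 1
        ext x
        exact (LinearMap.map_smul f c x).symm }
  refine ⟨(Module.evalEquiv k V).symm F', fun f => ?_⟩
  let f' : Module.Dual k V :=
    { toFun := f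
      map_add' := f.2.1
      map_smul' := f.2.2 }
  exact (Module.apply_evalEquiv_symm_apply k V f' F').symm

lemma DR.finite [FiniteDimensional k C] [Module.Finite Cᵐᵒᵖ V] : Module.Finite C (DR k C V) := by
  letI := kmod k Cᵐᵒᵖ V
  haveI := ktower k Cᵐᵒᵖ V
  haveI : Module.Finite k V := Module.Finite.trans Cᵐᵒᵖ V
  letI := kmod k C (DR k C V)
  haveI := ktower k C (DR k C V)
  have : Module.Finite k (Module.Dual k V) := inferInstance
  let e : Module.Dual k V →ₗ[k] DR k C V :=
    { toFun := fun f => (DR.mk' k C (fun x => f x) f.map_add (fun c x => LinearMap.map_smul f c x))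
      map_add' := fun _ _ => rfl
      map_smul' := fun c f => by
        ext x
        exact (LinearMap.map_smul f c x).symm }
  have : Module.Finite k (DR k C V) := Module.Finite.of_surjective e (fun f => ⟨
    { toFun := f
      map_add' := f.2.1
      map_smul' := f.2.2 }, rfl⟩)
  exact Module.Finite.of_restrictScalars_finite k C _

lemma DL.finite {Q : Type} [AddCommGroup Q] [Module C Q]
    [FiniteDimensional k C] [Module.Finite C Q] : Module.Finite Cᵐᵒᵖ (DL k C Q) := by
  letI := kmod k C Q
  haveI := ktower k C Q
  haveI : Module.Finite k Q := Module.Finite.trans C Q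
  letI := kmod k Cᵐᵒᵖ (DL k C Q)
  haveI := ktower k Cᵐᵒᵖ (DL k C Q)
  have : Module.Finite k (Module.Dual k Q) := inferInstance
  let e : Module.Dual k Q →ₗ[k] DL k C Q :=
    { toFun := fun f => (DL.mk' k C (fun x => f x) f.map_add (fun c x => LinearMap.map_smul f c x))
      map_add' := fun _ _ => rfl
      map_smul' := fun c f => by
        ext x
        exact (LinearMap.map_smul f c x).symm }
  have : Module.Finite k (DL k C Q) := Module.Finite.of_surjective e (fun f => ⟨
    { toFun := f
      map_add' := f.2.1
      map_smul' := f.2.2 }, rfl⟩)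
  exact Module.Finite.of_restrictScalars_finite k Cᵐᵒᵖ _

end

/-- the dual of a projective left module is injective -/
lemma DL.injective (Q : Type) [AddCommGroup Q] [Module C Q] [Module.Projective C Q] :
    Module.Injective Cᵐᵒᵖ (DL k C Q) := by
  constructor
  intro X Y _ _ _ _ f hf g
  let G : Q →ₗ[C] DR k C X :=
    { toFun := fun q => DR.mk' k C (fun x => g x q) (fun x y => by rw [map_add, DL.add_apply])
        (fun c x => by rw [g.map_smul, DL.smul_apply, unop_op, DL.map_k])
      map_add' := fun q q' => by ext x; exact map_add (g x) q q'
      map_smul' := fun a q => by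
        ext x
        change g x (a • q) = g (op a • x) q
        rw [g.map_smul]; rfl }
  let fs : DR k C Y →ₗ[C] DR k C X :=
    { toFun := fun η => DR.mk' k C (fun x => η (f x)) (fun x y => by rw [map_add, map_add])
        (fun c x => by rw [f.map_smul, DR.map_k])
      map_add' := fun q q' => rfl
      map_smul' := fun a q => by
        ext x
        change q (op a • f x) = q (f (op a • x))
        rw [f.map_smul] }
  obtain ⟨H, hH⟩ := lift_surj fs (fun ξ => by
    obtain ⟨η, hη⟩ := DR.extend k C f hf ξ
    exact ⟨η, DR.ext k C hη⟩) G
  refine ⟨{ toFun := fun y => DL.mk' k C (fun q => H q y)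
              (fun q q' => by rw [map_add, DR.add_apply])
              (fun c x => by rw [H.map_smul, DR.smul_apply, DR.map_k])
            map_add' := fun y y' => by ext q; exact map_add (H q) y y'
            map_smul' := fun a y => by
              ext q
              change H q (a • y) = H (unop a • q) y
              rw [H.map_smul]; rfl }, fun x => ?_⟩
  ext q
  exact congrArg (fun z : DR k C X => z x) (hH q)

/-- dual of a map of left modules -/
noncomputable def DL.map {Q Q' : Type} [AddCommGroup Q] [Module C Q] [AddCommGroup Q'] [Module C Q']
    (d : Q →ₗ[C] Q') : DL k C Q' →ₗ[Cᵐᵒᵖ] DL k C Q where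
  toFun η := DL.mk' k C (fun x => η (d x)) (fun x y => by rw [map_add, map_add])
        (fun c x => by rw [d.map_smul, DL.map_k])
  map_add' _ _ := rfl
  map_smul' a q := by
    ext x
    change q (unop a • d x) = q (d (unop a • x))
    rw [d.map_smul]

lemma DL.map_apply {Q Q' : Type} [AddCommGroup Q] [Module C Q] [AddCommGroup Q'] [Module C Q']
    (d : Q →ₗ[C] Q') (η : DL k C Q') (x : Q) : DL.map k C d η x = η (d x) := rfl

end Duals


section InjData

variable (k : Type) [Field k] (C : Type) [Ring C] [Algebra k C]

/-- transpose of a map into a dual -/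
noncomputable def pair {Q V : Type} [AddCommGroup Q] [Module C Q] [AddCommGroup V] [Module Cᵐᵒᵖ V]
    (f : Q →ₗ[C] DR k C V) : V →ₗ[Cᵐᵒᵖ] DL k C Q where
  toFun v := DL.mk' k C (fun y => f y v) (fun x y => by rw [map_add, DR.add_apply])
        (fun c x => by rw [f.map_smul, DR.smul_apply, DR.map_k])
  map_add' v v' := by ext y; exact map_add (f y) v v'
  map_smul' a v := by
    ext y
    change f y (a • v) = f (unop a • y) v
    rw [f.map_smul]; rfl

lemma pair_apply {Q V : Type} [AddCommGroup Q] [Module C Q] [AddCommGroup V] [Module Cᵐᵒᵖ V]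
    (f : Q →ₗ[C] DR k C V) (v : V) (y : Q) : pair k C f v y = f y v := rfl

lemma pair_inj {Q V : Type} [AddCommGroup Q] [Module C Q] [AddCommGroup V] [Module Cᵐᵒᵖ V]
    (f : Q →ₗ[C] DR k C V) (hf : Function.Surjective f) (v : V) (h : pair k C f v = 0) : v = 0 := by
  refine DR.sep k C v (fun ξ => ?_)
  obtain ⟨y, rfl⟩ := hf ξ
  rw [← pair_apply, h]; rfl

variable [FiniteDimensional k C]

lemma exists_inj_data (hgl : GlDimLE2 Cᵐᵒᵖ) (P : Mdl Cᵐᵒᵖ) [Module.Finite Cᵐᵒᵖ P] :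
    ∃ (I0 : Mdl Cᵐᵒᵖ) (ι : P →ₗ[Cᵐᵒᵖ] I0) (Q1 Q0 : Mdl C) (δ1 : Q1 →ₗ[C] Q0)
      (p : I0 →ₗ[Cᵐᵒᵖ] DL k C Q0)
      (r : DL k C Q1 →ₗ[Cᵐᵒᵖ] LinearMap.range (DL.map k C δ1)),
      Module.Injective Cᵐᵒᵖ I0 ∧ Function.Injective ι ∧ Module.Finite C Q1 ∧ Module.Finite C Q0 ∧
      Module.Projective C Q1 ∧ Module.Projective C Q0 ∧
      (∀ x, p (ι x) = 0) ∧ (∀ y, p y = 0 → ∃ x, ι x = y) ∧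
      (∀ x, DL.map k C δ1 (p x) = 0) ∧ (∀ y, DL.map k C δ1 y = 0 → ∃ x, p x = y) ∧
      (∀ y : LinearMap.range (DL.map k C δ1), r (y : DL k C Q1) = y) ∧
      (∀ (W : Mdl Cᵐᵒᵖ) (q : (Q1 →ₗ[C] C) →ₗ[Cᵐᵒᵖ] W), Function.Surjective q →
        (∀ g, q g = 0 ↔ ∃ f : Q0 →ₗ[C] C, g = f.comp δ1) → IsTauInvCosyz k C P W) := by
  have : IsArtinianRing C := IsArtinianRing.of_finite k C
  have : IsNoetherianRing C := IsNoetherianRing.of_finite k C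
  have : IsArtinianRing Cᵐᵒᵖ := IsArtinianRing.of_finite k Cᵐᵒᵖ
  have : IsNoetherianRing Cᵐᵒᵖ := IsNoetherianRing.of_finite k Cᵐᵒᵖ
  have := DR.finite k C (V := P)
  obtain ⟨n, f, hf⟩ := Module.Finite.exists_fin' C (DR k C P)
  have := DL.finite k C (Q := Fin n → C)
  have := DL.injective k C (Fin n → C)
  obtain ⟨I0, ι, hI0f, hI0, hι, hess⟩ := exists_env (pair k C f) (by
    rw [injective_iff_map_eq_zero]
    exact fun v h => pair_inj k C f hf v h)
  let V := I0 ⧸ LinearMap.range ι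
  have : Module.Finite C (DR k C V) := DR.finite k C
  obtain ⟨Q0, δ0, hQ0f, hQ0, hδ0, hδ0m⟩ := exists_cover (R := C) (DR k C V)
  obtain ⟨Q1, δ', hQ1f, hQ1, hδ', hδ'm⟩ := exists_cover (R := C) (LinearMap.ker δ0)
  let δ1 : Q1 →ₗ[C] Q0 := (LinearMap.ker δ0).subtype.comp δ'
  have hex : LinearMap.range δ1 = LinearMap.ker δ0 := by
    rw [LinearMap.range_comp_of_range_eq_top _ (LinearMap.range_eq_top.2 hδ'),
      Submodule.range_subtype]
  let p : I0 →ₗ[Cᵐᵒᵖ] DL k C Q0 := (pair k C δ0).comp (LinearMap.range ι).mkQ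
  have hpp : ∀ x, DL.map k C δ1 (p x) = 0 := by
    intro x
    ext y
    change δ0 (δ1 y) _ = 0
    have : δ1 y ∈ LinearMap.ker δ0 := hex ▸ LinearMap.mem_range_self _ _
    rw [LinearMap.mem_ker.1 this]; rfl
  have hpe : ∀ y, DL.map k C δ1 y = 0 → ∃ x, p x = y := by
    intro y hy
    have key : ∀ z, δ0 z = 0 → y z = 0 := by
      intro z hz
      have : z ∈ LinearMap.range δ1 := hex ▸ LinearMap.mem_ker.2 hz
      obtain ⟨w, rfl⟩ := this
      rw [← DL.map_apply, hy]; rfl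
    choose s hs using hδ0
    have key2 : ∀ z z', δ0 z = δ0 z' → y z = y z' := by
      intro z z' h
      have := key (z - z') (by rw [map_sub, h, sub_self])
      rwa [map_sub, sub_eq_zero] at this
    obtain ⟨v, hv⟩ := DR.eval_surj k C (V := V) (fun ξ => y (s ξ))
      (fun f g => by rw [← map_add]; exact key2 _ _ (by rw [map_add, hs, hs, hs]))
      (fun c f => by rw [← DL.map_k]; exact key2 _ _ (by rw [δ0.map_smul, hs, hs]))
    obtain ⟨x, rfl⟩ := (LinearMap.range ι).mkQ_surjective v
    refine ⟨x, ?_⟩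
    ext z
    change δ0 z _ = _
    rw [← hv]
    exact key2 _ _ (hs _)
  have := DL.injective k C Q0
  have hI2 : Module.Injective Cᵐᵒᵖ (LinearMap.range (DL.map k C δ1)) :=
    inj_I2 hgl p (DL.map k C δ1).rangeRestrict (fun x => Subtype.ext (hpp x))
      (fun y hy => hpe y (congrArg Subtype.val hy)) (LinearMap.surjective_rangeRestrict _)
  obtain ⟨r, hr⟩ := Module.Injective.out (LinearMap.range (DL.map k C δ1)).subtype
    (Submodule.subtype_injective _) LinearMap.id
  refine ⟨I0, ι, Q1, Q0, δ1, p, r, hI0, hι, hQ1f, hQ0f, hQ1, hQ0, ?_, ?_, hpp, hpe, hr, ?_⟩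
  · intro x
    have : (LinearMap.range ι).mkQ (ι x) = 0 := by simp
    change pair k C δ0 _ = 0
    rw [this, map_zero]
  · intro y hy
    have : (LinearMap.range ι).mkQ y = 0 := pair_inj k C δ0 hδ0 _ hy
    rw [Submodule.mkQ_apply, Submodule.Quotient.mk_eq_zero] at this
    exact this
  · intro W q hq hq2
    refine ⟨ModuleCat.of _ V, ⟨I0, ι, ⟨hI0, hι, hess⟩, ⟨LinearEquiv.refl _ _⟩⟩,
      ModuleCat.of _ (DR k C V), ⟨fun v ξ => (ξ : DR k C V) v, ?_, ?_, ?_, ?_, ?_, ?_⟩,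
      Q1, Q0, δ1, δ0, ⟨⟨hQ0, hδ0, hδ0m⟩, hQ1, hex, ?_⟩, q, hq, hq2⟩
    · intro v v' ξ; exact map_add (ξ : DR k C V) v v'
    · intro v ξ ξ'; rfl
    · intro c v ξ; exact DR.map_k k C (ξ : DR k C V) c v
    · intro a v ξ; rfl
    · intro v h; exact DR.sep k C v h
    · intro ξ h; exact DR.ext k C h
    · intro N hN
      refine hδ'm N ?_
      rw [← hN]
      congr 1
      ext z
      simp [δ1]

end InjData


section ThmK

variable (k : Type) [Field k] (C : Type) [Ring C] [Algebra k C]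

lemma perfect [FiniteDimensional k C] {DC : Type} [AddCommGroup DC] [Module Cᵐᵒᵖ DC]
    (φ : DC → C → k)
    (h1 : ∀ n n' m, φ (n + n') m = φ n m + φ n' m)
    (h2 : ∀ n m m', φ n (m + m') = φ n m + φ n m')
    (h3 : ∀ (c : k) n m, φ n ((algebraMap k C c) * m) = c * φ n m)
    (h4 : ∀ (a : C) n m, φ (op a • n) m = φ n (a * m))
    (h5 : ∀ n, (∀ m, φ n m = 0) → n = 0)
    (h6 : ∀ m, (∀ n, φ n m = 0) → m = 0) :
    (∀ ζ : DL k C C, ∃ n, ∀ c, φ n c = ζ c) ∧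
    (∀ F : DC → k, (∀ n n', F (n + n') = F n + F n') →
      (∀ (c : k) n, F (op (algebraMap k C c) • n) = c * F n) → ∃ m, ∀ n, F n = φ n m) := by
  letI := kmod k Cᵐᵒᵖ DC
  let φ' : DC →ₗ[k] C →ₗ[k] k := LinearMap.mk₂ k φ h1
    (fun c n m => by
      change φ (op (algebraMap k C c) • n) m = _
      rw [h4, h3]; rfl)
    h2 (fun c n m => by rw [Algebra.smul_def, h3]; rfl)
  have : φ'.IsPerfPair := LinearMap.IsPerfPair.of_injective'
    (by
      rw [injective_iff_map_eq_zero]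
      exact fun n h => h5 n (fun m => LinearMap.congr_fun h m))
    (by
      rw [injective_iff_map_eq_zero]
      exact fun n h => h6 n (fun m => LinearMap.congr_fun h m))
  constructor
  · intro ζ
    let ζ' : C →ₗ[k] k :=
      { toFun := ζ
        map_add' := ζ.2.1
        map_smul' := fun c x => by rw [Algebra.smul_def]; exact ζ.2.2 c x }
    obtain ⟨n, hn⟩ := (LinearMap.IsPerfPair.bijective_left φ').2 ζ'
    exact ⟨n, fun c => LinearMap.congr_fun hn c⟩
  · intro F hF1 hF2
    let F' : DC →ₗ[k] k :=
      { toFun := F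
        map_add' := hF1
        map_smul' := hF2 }
    obtain ⟨n, hn⟩ := (LinearMap.IsPerfPair.bijective_right φ').2 F'
    exact ⟨n, fun c => (LinearMap.congr_fun hn c).symm⟩

variable {C}

/-- balanced maps `P × E → X` -/
structure Bal {P E X : Type} [AddCommGroup P] [Module Cᵐᵒᵖ P] [AddCommGroup E] [Module C E]
    [Module Cᵐᵒᵖ E] [AddCommGroup X] [Module Cᵐᵒᵖ X] (β : P → E → X) : Prop where
  addl : ∀ p p' e, β (p + p') e = β p e + β p' e
  addr : ∀ p e e', β p (e + e') = β p e + β p e'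
  bal : ∀ (c : C) p e, β (op c • p) e = β p (c • e)
  smul : ∀ (c : C) p e, β p (op c • e) = op c • β p e

variable {E : Type} [AddCommGroup E] [Module C E] [Module Cᵐᵒᵖ E]

/-- dual basis for right modules with functionals to `C` -/
lemma dualBasisR (P : Type) [AddCommGroup P] [Module Cᵐᵒᵖ P] [Module.Finite Cᵐᵒᵖ P]
    [Module.Projective Cᵐᵒᵖ P] :
    ∃ (n : ℕ) (g : Fin n → (P →ₗ[Cᵐᵒᵖ] C)) (x : Fin n → P), ∀ y, ∑ i, op (g i y) • x i = y := by
  obtain ⟨n, g, x, h⟩ := dualBasis (R := Cᵐᵒᵖ) P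
  exact ⟨n, fun i =>
    { toFun := fun y => unop (g i y)
      map_add' := fun y y' => by rw [map_add]; rfl
      map_smul' := fun a y => by rw [map_smul]; rfl }, x, h⟩

lemma exists_Bmap {P X R2 : Type} [AddCommGroup P] [Module Cᵐᵒᵖ P] [Module.Finite Cᵐᵒᵖ P]
    [Module.Projective Cᵐᵒᵖ P] [AddCommGroup X] [Module Cᵐᵒᵖ X]
    [AddCommGroup R2] [Module Cᵐᵒᵖ R2]
    (q : (R2 →ₗ[Cᵐᵒᵖ] C) →ₗ[C] E) (β : P → E → X) (hβ : Bal (C := C) β) :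
    ∃ Bm : (R2 →ₗ[Cᵐᵒᵖ] P) → X,
      (∀ w w', Bm (w + w') = Bm w + Bm w') ∧
      (∀ p g (w : R2 →ₗ[Cᵐᵒᵖ] P), (∀ y, w y = op (g y) • p) → Bm w = β p (q g)) ∧
      (∀ (f2 : R2 →ₗ[Cᵐᵒᵖ] R2) (c : C), (∀ g, q (g.comp f2) = op c • q g) →
        ∀ w, Bm (w.comp f2) = op c • Bm w) ∧
      (∀ w, (∀ g : P →ₗ[Cᵐᵒᵖ] C, q (g.comp w) = 0) → Bm w = 0) := by
  obtain ⟨n, g, x, h⟩ := dualBasisR (C := C) P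
  have h0 : ∀ p, β p 0 = 0 := fun p => by
    have := hβ.addr p 0 0
    rw [add_zero] at this
    exact left_eq_add.1 this
  have h0' : ∀ e, β 0 e = 0 := fun p => by
    have := hβ.addl 0 0 p
    rw [add_zero] at this
    exact left_eq_add.1 this
  have hsum : ∀ (y : Fin n → P) e, ∑ i, β (y i) e = β (∑ i, y i) e := by
    intro y e
    exact (map_sum (⟨⟨fun p => β p e, h0' e⟩, fun p p' => hβ.addl p p' e⟩ : P →+ X) y _).symm
  refine ⟨fun w => ∑ i, β (x i) (q ((g i).comp w)), ?_, ?_, ?_, ?_⟩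
  · intro w w'
    rw [← Finset.sum_add_distrib]
    refine Finset.sum_congr rfl fun i _ => ?_
    rw [LinearMap.comp_add, map_add, hβ.addr]
  · intro p γ w hw
    have : ∀ i, (g i).comp w = g i p • γ := by
      intro i
      ext y
      rw [LinearMap.comp_apply, hw, LinearMap.map_smul]
      rfl
    simp only [this, LinearMap.map_smul, ← hβ.bal]
    rw [hsum, h]
  · intro f2 c hc w
    rw [Finset.smul_sum]
    refine Finset.sum_congr rfl fun i _ => ?_
    rw [← LinearMap.comp_assoc, hc, hβ.smul]
  · intro w hw
    refine Finset.sum_eq_zero fun i _ => ?_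
    rw [hw, h0]

end ThmK


section ThmK2

variable (k : Type) [Field k] (C : Type) [Ring C] [Algebra k C] [FiniteDimensional k C]
  (E : Type) [AddCommGroup E] [Module C E] [Module Cᵐᵒᵖ E]

theorem thmK (hgl : GlDimLE2 Cᵐᵒᵖ) (hE : IsRelExt k C E) (P : Mdl Cᵐᵒᵖ) [Module.Finite Cᵐᵒᵖ P]
    [Module.Projective Cᵐᵒᵖ P] :
    ∃ (Q1 Q0 : Mdl C) (δ1 : Q1 →ₗ[C] Q0),
      Module.Finite C Q1 ∧ Module.Finite C Q0 ∧ Module.Projective C Q1 ∧ Module.Projective C Q0 ∧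
      (∀ (W : Mdl Cᵐᵒᵖ) (q : (Q1 →ₗ[C] C) →ₗ[Cᵐᵒᵖ] W), Function.Surjective q →
        (∀ g, q g = 0 ↔ ∃ f : Q0 →ₗ[C] C, g = f.comp δ1) → IsTauInvCosyz k C P W) ∧
      (∀ X : Mdl Cᵐᵒᵖ, PdLE1 Cᵐᵒᵖ X → ∀ a : X →ₗ[Cᵐᵒᵖ] DL k C Q1,
        (∀ x, a x ∈ LinearMap.range (DL.map k C δ1)) →
        ∃ v : X →ₗ[Cᵐᵒᵖ] DL k C Q0, ∀ x, DL.map k C δ1 (v x) = a x) ∧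
      ∀ (X : Type) [AddCommGroup X] [Module Cᵐᵒᵖ X] (β : P → E → X), Bal (C := C) β →
        ∃ F : (Q1 →ₗ[C] C) →ₗ[Cᵐᵒᵖ] X, (∀ f : Q0 →ₗ[C] C, F (f.comp δ1) = 0) ∧
          ∀ p e, ∃ g, F g = β p e ∧
            ∀ ζ : DL k C C, DL.map k C g ζ ∈ LinearMap.range (DL.map k C δ1) := by
  obtain ⟨I0, ι, Q1, Q0, δ1, p, r, hI0, hι, hQ1f, hQ0f, hQ1, hQ0, hpι, hpex, hDp, hDex, hr, htau⟩ :=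
    exists_inj_data k C hgl P
  obtain ⟨DC, φ, h1, h2, h3, h4, h5, h6, R2, R1, R0, e2, e1, e0, hR2, hR1, hR0, he2, he0,
    h21, h10, q, hq, hqz, hact⟩ := hE
  obtain ⟨perf1, perf2⟩ := perfect k C φ h1 h2 h3 h4 h5 h6
  have hinj0 := DL.injective k C Q0
  let S : Setup Cᵐᵒᵖ P I0 (DL k C Q0) (LinearMap.range (DL.map k C δ1)) R2 R1 R0 DC :=
    { ι := ι
      p := p
      π := (DL.map k C δ1).rangeRestrict
      e2 := e2
      e1 := e1
      e0 := e0
      hI0 := hI0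
      hI1 := hinj0
      hR1 := hR1
      hR0 := hR0
      ι_inj := hι
      pι := hpι
      p_ex := hpex
      πp := fun x => Subtype.ext (hDp x)
      π_ex := fun y hy => hDex y (congrArg Subtype.val hy)
      π_surj := LinearMap.surjective_rangeRestrict _
      e2_inj := he2
      e12 := fun x => by
        have : e2 x ∈ LinearMap.ker e1 := h21 ▸ LinearMap.mem_range_self _ _
        exact this
      e1_ex := fun y hy => by
        have : y ∈ LinearMap.range e2 := h21 ▸ LinearMap.mem_ker.2 hy
        exact this
      e01 := fun x => by
        have : e1 x ∈ LinearMap.ker e0 := h10 ▸ LinearMap.mem_range_self _ _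
        exact this
      e0_ex := fun y hy => by
        have : y ∈ LinearMap.range e1 := h10 ▸ LinearMap.mem_ker.2 hy
        exact this
      e0_surj := he0 }
  refine ⟨Q1, Q0, δ1, hQ1f, hQ0f, hQ1, hQ0, htau, ?_, ?_⟩
  · intro X hX a ha
    obtain ⟨v, hv⟩ := lift_pd1 S.p S.π S.πp S.π_ex S.π_surj X hX (a.codRestrict _ ha)
    exact ⟨v, fun x => congrArg Subtype.val (hv x)⟩
  intro X _ _ β hβ
  obtain ⟨Bm, Badd, Brank, Bact, Bzero⟩ := exists_Bmap q β hβ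
  have Bt : ∀ t : R1 →ₗ[Cᵐᵒᵖ] P, Bm (t.comp e2) = 0 := fun t => Bzero _ fun g =>
    (hqz _).2 ⟨g.comp t, by rw [LinearMap.comp_assoc]⟩
  choose cw hcw using S.chain_exists
  have Buniq : ∀ u w, S.Chain u w → Bm (cw u) = Bm w := by
    intro u w h
    have h' := S.chain_add (hcw u) (S.chain_neg h)
    obtain ⟨t, ht⟩ := S.chain_zero 0 (by intro x; simp) h'
    have hh : cw u = w + t.comp e2 := by
      rw [← show cw u + -w = t.comp e2 from ht]; abel
    rw [hh, Badd, Bt, add_zero]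
  have Blift : ∀ (u : DC →ₗ[Cᵐᵒᵖ] LinearMap.range (DL.map k C δ1)) (v : DC →ₗ[Cᵐᵒᵖ] DL k C Q0),
      (∀ x, S.π (v x) = u x) → Bm (cw u) = 0 := by
    intro u v h
    obtain ⟨t, ht⟩ := S.chain_zero v h (hcw u)
    rw [ht]; exact Bt t
  let θ : DC →ₗ[Cᵐᵒᵖ] DL k C C :=
    { toFun := fun n => DL.mk' k C (φ n) (h2 n) (fun c x => h3 c n x)
      map_add' := fun n n' => by ext m; exact h1 n n' m
      map_smul' := fun a n => by ext m; exact h4 (unop a) n m }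
  let hat : (Q1 →ₗ[C] C) → (DC →ₗ[Cᵐᵒᵖ] LinearMap.range (DL.map k C δ1)) :=
    fun g => r.comp ((DL.map k C g).comp θ)
  let F : (Q1 →ₗ[C] C) →ₗ[Cᵐᵒᵖ] X :=
    { toFun := fun g => Bm (cw (hat g))
      map_add' := fun g g' => by
        have e : hat (g + g') = hat g + hat g' := by
          refine LinearMap.ext fun n => ?_
          change r _ = r _ + r _
          rw [← map_add]
          congr 1
          ext y
          exact h2 n (g y) (g' y)
        rw [e, Buniq _ _ (S.chain_add (hcw (hat g)) (hcw (hat g'))), Badd]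
      map_smul' := fun a g => by
        obtain ⟨μ, f0, f1, f2, hμ, c0, c1, c2, hf2⟩ := hact (unop a)
        have e : hat (a • g) = (hat g).comp μ := by
          refine LinearMap.ext fun n => ?_
          change r _ = r _
          congr 1
          ext y
          exact (hμ n (g y)).symm
        rw [e, Buniq _ _ (S.chain_comp (hcw (hat g)) μ f0 f1 f2 c0 c1 c2), Bact f2 _ hf2]
        rfl }
  refine ⟨F, ?_, ?_⟩
  · intro f
    refine Blift _ ((DL.map k C f).comp θ) (fun n => ?_)
    exact (hr (S.π (((DL.map k C f).comp θ) n))).symm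
  · intro x e
    obtain ⟨g0, rfl⟩ := hq e
    let w : R2 →ₗ[Cᵐᵒᵖ] P :=
      { toFun := fun y => op (g0 y) • x
        map_add' := fun y y' => by rw [map_add, MulOpposite.op_add, add_smul]
        map_smul' := fun a y => by
          rw [LinearMap.map_smul, RingHom.id_apply, ← mul_smul]; rfl }
    obtain ⟨u, hu⟩ := S.chain_surj w
    have : ∀ y : Q1, ∃ m : C, ∀ n, ((u n : LinearMap.range (DL.map k C δ1)) : DL k C Q1) y = φ n m :=
      fun y => perf2 _ (fun n n' => by rw [map_add]; rfl) (fun c n => by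
        rw [LinearMap.map_smul]
        exact DL.map_k k C ((u n : LinearMap.range (DL.map k C δ1)) : DL k C Q1) c y)
    choose g hg using this
    have inj6 : ∀ m m', (∀ n, φ n m = φ n m') → m = m' := by
      intro m m' h
      rw [← sub_eq_zero]
      refine h6 _ fun n => ?_
      have : φ n (m - m') = φ n m - φ n m' := map_sub (θ n) m m'
      rw [this, h, sub_self]
    let g' : Q1 →ₗ[C] C :=
      { toFun := g
        map_add' := fun y y' => inj6 _ _ fun n => by
          rw [h2, ← hg, ← hg, ← hg, map_add]
        map_smul' := fun a y => inj6 _ _ fun n => by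
          have := h4 a n (g y)
          rw [← hg (a • y), RingHom.id_apply, smul_eq_mul, ← h4, ← hg y, LinearMap.map_smul]
          rfl }
    have hgu : ∀ n, DL.map k C g' (θ n) = u n := by
      intro n
      ext y
      exact (hg y n).symm
    have hat_g : hat g' = u := by
      refine LinearMap.ext fun n => ?_
      change r (DL.map k C g' (θ n)) = _
      rw [hgu, hr]
    refine ⟨g', ?_, ?_⟩
    · change Bm (cw (hat g')) = _
      rw [hat_g, Buniq _ _ hu, Brank x g0 w (fun y => rfl)]
    · intro ζ
      obtain ⟨n, hn⟩ := perf1 ζ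
      have : ζ = θ n := by ext c; exact (hn c).symm
      rw [this, hgu]
      exact (u n).2

end ThmK2


section Cons

variable (k : Type) [Field k] (C : Type) [Ring C] [Algebra k C] [FiniteDimensional k C]
  (E : Type) [AddCommGroup E] [Module C E] [Module Cᵐᵒᵖ E]

lemma bal_zero_a (hgl : GlDimLE2 Cᵐᵒᵖ) (hE : IsRelExt k C E) (P : Mdl Cᵐᵒᵖ)
    [Module.Finite Cᵐᵒᵖ P] [Module.Projective Cᵐᵒᵖ P] (X : Mdl Cᵐᵒᵖ)
    (hX : ∀ W, IsTauInvCosyz k C P W → HomZero Cᵐᵒᵖ W X)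
    (β : P → E → X) (hβ : Bal (C := C) β) (x : P) (e : E) : β x e = 0 := by
  obtain ⟨Q1, Q0, δ1, hQ1f, hQ0f, hQ1, hQ0, htau, -, hK⟩ := thmK k C E hgl hE P
  obtain ⟨F, hF, hs⟩ := hK X β hβ
  obtain ⟨g, hg, -⟩ := hs x e
  let N : Submodule Cᵐᵒᵖ (Q1 →ₗ[C] C) :=
    { carrier := {g | ∃ f : Q0 →ₗ[C] C, g = f.comp δ1}
      add_mem' := by
        rintro _ _ ⟨f, rfl⟩ ⟨f', rfl⟩
        exact ⟨f + f', by rw [LinearMap.add_comp]⟩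
      zero_mem' := ⟨0, by rw [LinearMap.zero_comp]⟩
      smul_mem' := by
        rintro a _ ⟨f, rfl⟩
        exact ⟨a • f, rfl⟩ }
  have hW := htau (ModuleCat.of _ ((Q1 →ₗ[C] C) ⧸ N)) N.mkQ N.mkQ_surjective (fun g => by
    rw [Submodule.mkQ_apply, Submodule.Quotient.mk_eq_zero]; rfl)
  have hz := hX _ hW (N.liftQ F (by
    rintro _ ⟨f, rfl⟩
    exact hF f))
  have := LinearMap.congr_fun hz (N.mkQ g)
  rw [← hg]
  exact this

lemma bal_zero_b (hgl : GlDimLE2 Cᵐᵒᵖ) (hE : IsRelExt k C E) (P : Mdl Cᵐᵒᵖ)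
    [Module.Finite Cᵐᵒᵖ P] [Module.Projective Cᵐᵒᵖ P] (X : Mdl Cᵐᵒᵖ)
    (hX : PdLE1 Cᵐᵒᵖ X)
    (β : P → E → X) (hβ : Bal (C := C) β) (x : P) (e : E) : β x e = 0 := by
  obtain ⟨Q1, Q0, δ1, hQ1f, hQ0f, hQ1, hQ0, -, hpd, hK⟩ := thmK k C E hgl hE P
  obtain ⟨F, hF, hs⟩ := hK X β hβ
  obtain ⟨g, hg, hland⟩ := hs x e
  rw [← hg]
  refine DR.sep k C _ fun ξ => ?_
  let ζ : X → DL k C C := fun z => DL.mk' k C (fun c => ξ (op c • z))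
    (fun c c' => by rw [MulOpposite.op_add, add_smul, map_add])
    (fun c c' => by rw [smul_eq_mul, MulOpposite.op_mul, mul_smul, ← DR.map_k k C ξ, ← mul_smul,
      ← mul_smul, ← MulOpposite.op_mul, ← MulOpposite.op_mul, Algebra.commutes])
  let a : X →ₗ[Cᵐᵒᵖ] DL k C Q1 :=
    { toFun := fun z => DL.map k C g (ζ z)
      map_add' := fun z z' => by
        ext y
        change ξ (op (g y) • (z + z')) = ξ (op (g y) • z) + ξ (op (g y) • z')
        rw [smul_add, map_add]
      map_smul' := fun c z => by
        ext y
        change ξ (op (g y) • c • z) = ξ (op (g (unop c • y)) • z)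
        rw [g.map_smul, ← mul_smul]; rfl }
  obtain ⟨v, hv⟩ := hpd X hX a (fun z => hland _)
  have hv' : ∀ z y, v z (δ1 y) = ξ (op (g y) • z) := fun z y =>
    congrArg (fun f : DL k C Q1 => f y) (hv z)
  obtain ⟨n, gi, xi, hi⟩ := dualBasis (R := C) Q1
  obtain ⟨m, fj, yj, hj⟩ := dualBasis (R := C) Q0
  have hg2 : g = ∑ i, op (g (xi i)) • gi i := by
    ext y
    conv_lhs => rw [← hi y]
    simp only [map_sum, LinearMap.map_smul, LinearMap.sum_apply, LinearMap.smul_apply]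
    rfl
  have hf2 : ∀ j, (fj j).comp δ1 = ∑ i, op (fj j (δ1 (xi i))) • gi i := by
    intro j
    ext y
    conv_lhs => rw [← hi y]
    simp only [map_sum, LinearMap.map_smul, LinearMap.sum_apply, LinearMap.smul_apply]
    rfl
  have e1 : ξ (F g) = ∑ i, v (F (gi i)) (δ1 (xi i)) := by
    conv_lhs => rw [hg2]
    simp only [map_sum, LinearMap.map_smul, hv']
  have e2 : ∀ i, v (F (gi i)) (δ1 (xi i)) =
      ∑ j, v (op (fj j (δ1 (xi i))) • F (gi i)) (yj j) := by
    intro i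
    conv_lhs => rw [← hj (δ1 (xi i))]
    rw [map_sum]
    refine Finset.sum_congr rfl fun j _ => ?_
    rw [LinearMap.map_smul]; rfl
  rw [e1]
  simp only [e2]
  rw [Finset.sum_comm]
  refine Finset.sum_eq_zero fun j _ => ?_
  have e3 : F ((fj j).comp δ1) = ∑ i, op (fj j (δ1 (xi i))) • F (gi i) := by
    rw [hf2 j]
    simp only [map_sum, LinearMap.map_smul]
  have e4 : v (F ((fj j).comp δ1)) (yj j) = 0 := by
    rw [hF, map_zero]; rfl
  rw [e3, map_sum] at e4
  rw [← e4]
  let ev : DL k C Q0 →+ k := ⟨⟨fun f => f (yj j), rfl⟩, fun f f' => rfl⟩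
  exact (map_sum ev (fun i => v (op (fj j (δ1 (xi i))) • F (gi i))) Finset.univ).symm

lemma E_finite [SMulCommClass C Cᵐᵒᵖ E] (hgl : GlDimLE2 Cᵐᵒᵖ) (hE : IsRelExt k C E) :
    Module.Finite Cᵐᵒᵖ E := by
  have : Module.Finite Cᵐᵒᵖ (ModuleCat.of Cᵐᵒᵖ Cᵐᵒᵖ) := inferInstanceAs (Module.Finite Cᵐᵒᵖ Cᵐᵒᵖ)
  have : Module.Projective Cᵐᵒᵖ (ModuleCat.of Cᵐᵒᵖ Cᵐᵒᵖ) :=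
    inferInstanceAs (Module.Projective Cᵐᵒᵖ Cᵐᵒᵖ)
  obtain ⟨Q1, Q0, δ1, hQ1f, hQ0f, hQ1, hQ0, -, -, hK⟩ := thmK k C E hgl hE (ModuleCat.of _ Cᵐᵒᵖ)
  let β : Cᵐᵒᵖ → E → E := fun a e => unop a • e
  obtain ⟨F, -, hs⟩ := hK E β
    { addl := fun a a' e => add_smul (unop a) (unop a') e
      addr := fun a e e' => smul_add (unop a) e e'
      bal := fun c a e => mul_smul (unop a) c e
      smul := fun c a e => smul_comm (unop a) (op c) e }
  obtain ⟨n, gi, xi, hi⟩ := dualBasis (R := C) Q1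
  refine Module.Finite.of_surjective (F.comp (Fintype.linearCombination Cᵐᵒᵖ gi)) (fun e => ?_)
  obtain ⟨g, hg, -⟩ := hs (1 : Cᵐᵒᵖ) e
  refine ⟨fun i => op (g (xi i)), ?_⟩
  have hg2 : g = ∑ i, op (g (xi i)) • gi i := by
    ext y
    conv_lhs => rw [← hi y]
    simp only [map_sum, LinearMap.map_smul, LinearMap.sum_apply, LinearMap.smul_apply]
    rfl
  rw [LinearMap.comp_apply, Fintype.linearCombination_apply, ← hg2, hg]
  exact one_smul C e

end Cons


section LemmaA

/-- rank one maps -/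
def outer {A : Type} [Ring A] {P M : Type} [AddCommGroup P] [Module Aᵐᵒᵖ P] [AddCommGroup M]
    [Module Aᵐᵒᵖ M] (g : P →ₗ[Aᵐᵒᵖ] A) (m : M) : P →ₗ[Aᵐᵒᵖ] M where
  toFun x := op (g x) • m
  map_add' y y' := by rw [map_add, MulOpposite.op_add, add_smul]
  map_smul' a y := by
    rw [LinearMap.map_smul, RingHom.id_apply, ← mul_smul]; rfl

lemma outer_apply {A : Type} [Ring A] {P M : Type} [AddCommGroup P] [Module Aᵐᵒᵖ P]
    [AddCommGroup M] [Module Aᵐᵒᵖ M] (g : P →ₗ[Aᵐᵒᵖ] A) (m : M) (x : P) :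
    outer g m x = op (g x) • m := rfl

lemma tau_zero (k : Type) [Field k] (A : Type) [Ring A] [Algebra k A] (M T P1 P0 : Mdl Aᵐᵒᵖ)
    [Module.Finite Aᵐᵒᵖ P1] [Module.Projective Aᵐᵒᵖ P1]
    [Module.Finite Aᵐᵒᵖ P0] [Module.Projective Aᵐᵒᵖ P0]
    (d1 : P1 →ₗ[Aᵐᵒᵖ] P0)
    (hfac : ∀ g : P1 →ₗ[Aᵐᵒᵖ] M, ∃ h : P0 →ₗ[Aᵐᵒᵖ] M, g = h.comp d1)
    (Tr : Mdl A) (q : (P1 →ₗ[Aᵐᵒᵖ] A) →ₗ[A] Tr) (hq : Function.Surjective q)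
    (hqz : ∀ g : P1 →ₗ[Aᵐᵒᵖ] A, q g = 0 ↔ ∃ f : P0 →ₗ[Aᵐᵒᵖ] A, g = f.comp d1)
    (hT : IskDual k A T Tr) : HomZero Aᵐᵒᵖ M T := by
  intro F
  obtain ⟨ψ, h1, h2, h3, h4, h5, h6⟩ := hT
  refine LinearMap.ext fun m => h5 _ fun y => ?_
  obtain ⟨g, rfl⟩ := hq y
  have ha0 : ∀ n, ψ n 0 = 0 := fun n => by
    have := h2 n 0 0
    rw [add_zero] at this
    exact left_eq_add.1 this
  have hb0 : ∀ y, ψ 0 y = 0 := fun y => by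
    have := h1 0 0 y
    rw [add_zero] at this
    exact left_eq_add.1 this
  let lm : M → (P1 →ₗ[Aᵐᵒᵖ] A) →+ k := fun m =>
    ⟨⟨fun g => ψ (F m) (q g), by rw [map_zero, ha0]⟩, fun g g' => by
      change ψ _ _ = ψ _ _ + ψ _ _
      rw [map_add, h2]⟩
  let lg : (P1 →ₗ[Aᵐᵒᵖ] A) → M →+ k := fun g =>
    ⟨⟨fun m => ψ (F m) (q g), by rw [map_zero, hb0]⟩, fun m m' => by
      change ψ _ _ = ψ _ _ + ψ _ _
      rw [map_add, h1]⟩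
  have hsw : ∀ g m, lm m g = lg g m := fun _ _ => rfl
  have hbal : ∀ (a : A) g m, lg g (op a • m) = lm m (a • g) := by
    intro a g m
    change ψ (F (op a • m)) (q g) = ψ (F m) (q (a • g))
    rw [F.map_smul, h4, q.map_smul]
  obtain ⟨n, gi, xi, hi⟩ := dualBasisR (C := A) P1
  obtain ⟨n', fj, yj, hj⟩ := dualBasisR (C := A) P0
  have hexp : ∀ g : P1 →ₗ[Aᵐᵒᵖ] A, g = ∑ i, g (xi i) • gi i := by
    intro g
    ext y
    conv_lhs => rw [← hi y]
    simp only [map_sum, LinearMap.map_smul, LinearMap.sum_apply, LinearMap.smul_apply]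
    rfl
  have e1 : ∀ (g : P1 →ₗ[Aᵐᵒᵖ] A) m, lm m g = ∑ i, lg (gi i) (op (g (xi i)) • m) := by
    intro g m
    conv_lhs => rw [hexp g]
    rw [map_sum]
    exact Finset.sum_congr rfl fun i _ => (hbal _ _ _).symm
  change lm m g = 0
  obtain ⟨h, hh⟩ := hfac (outer g m)
  rw [e1]
  have e2 : ∀ i, op (g (xi i)) • m = ∑ j, op (fj j (d1 (xi i))) • h (yj j) := by
    intro i
    rw [← outer_apply, hh, LinearMap.comp_apply]
    conv_lhs => rw [← hj (d1 (xi i))]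
    simp only [map_sum, LinearMap.map_smul]
  simp only [e2, map_sum]
  rw [Finset.sum_comm]
  refine Finset.sum_eq_zero fun j _ => ?_
  have e3 := e1 ((fj j).comp d1) (h (yj j))
  simp only [LinearMap.comp_apply] at e3
  rw [← e3]
  change ψ _ (q _) = 0
  rw [(hqz _).2 ⟨_, rfl⟩, ha0]

variable (k : Type) [Field k] (C : Type) [Ring C] [Algebra k C] [FiniteDimensional k C]

lemma tau_factor (M P1 P0 : Mdl Cᵐᵒᵖ) (hrigid : TauRigid k C M) [Module.Finite Cᵐᵒᵖ P1]
    (d1 : P1 →ₗ[Cᵐᵒᵖ] P0) (d0 : P0 →ₗ[Cᵐᵒᵖ] M) (hpres : IsMinPres Cᵐᵒᵖ d1 d0)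
    (h0 : P1 →ₗ[Cᵐᵒᵖ] M) : ∃ h : P0 →ₗ[Cᵐᵒᵖ] M, h0 = h.comp d1 := by
  have hP1 := hpres.2.1
  letI := kmod k Cᵐᵒᵖ M
  haveI : SMulCommClass Cᵐᵒᵖ k M := ⟨fun a c m => by
    change a • algebraMap k Cᵐᵒᵖ c • m = algebraMap k Cᵐᵒᵖ c • a • m
    rw [← mul_smul, ← mul_smul, Algebra.commutes]⟩
  let U : Submodule k (P1 →ₗ[Cᵐᵒᵖ] M) :=
    { carrier := {g | ∃ h : P0 →ₗ[Cᵐᵒᵖ] M, g = h.comp d1}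
      add_mem' := by
        rintro _ _ ⟨f, rfl⟩ ⟨f', rfl⟩
        exact ⟨f + f', by rw [LinearMap.add_comp]⟩
      zero_mem' := ⟨0, by rw [LinearMap.zero_comp]⟩
      smul_mem' := by
        rintro a _ ⟨f, rfl⟩
        exact ⟨a • f, rfl⟩ }
  by_contra hcon
  obtain ⟨Λ, hΛ0, hΛ⟩ := Submodule.exists_le_ker_of_notMem (p := U) (v := h0) hcon
  let N : Submodule C (P1 →ₗ[Cᵐᵒᵖ] C) :=
    { carrier := {g | ∃ f : P0 →ₗ[Cᵐᵒᵖ] C, g = f.comp d1}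
      add_mem' := by
        rintro _ _ ⟨f, rfl⟩ ⟨f', rfl⟩
        exact ⟨f + f', by rw [LinearMap.add_comp]⟩
      zero_mem' := ⟨0, by rw [LinearMap.zero_comp]⟩
      smul_mem' := by
        rintro a _ ⟨f, rfl⟩
        exact ⟨a • f, rfl⟩ }
  let Tr := (P1 →ₗ[Cᵐᵒᵖ] C) ⧸ N
  have add1 : ∀ (g g' : P1 →ₗ[Cᵐᵒᵖ] C) (m : M), outer (g + g') m = outer g m + outer g' m := by
    intro g g' m
    ext x
    change op (g x + g' x) • m = op (g x) • m + op (g' x) • m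
    rw [MulOpposite.op_add, add_smul]
  have add2 : ∀ (g : P1 →ₗ[Cᵐᵒᵖ] C) (m m' : M), outer g (m + m') = (outer g m + outer g m' : P1 →ₗ[Cᵐᵒᵖ] M) := by
    intro g m m'
    ext x
    exact smul_add _ _ _
  have sm1 : ∀ (c : k) (g : P1 →ₗ[Cᵐᵒᵖ] C) (m : M),
      outer (algebraMap k C c • g) m = (c • outer g m : P1 →ₗ[Cᵐᵒᵖ] M) := by
    intro c g m
    ext x
    change op (algebraMap k C c * g x) • m = op (algebraMap k C c) • op (g x) • m
    rw [Algebra.commutes, MulOpposite.op_mul, mul_smul]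
  have sm2 : ∀ (a : C) (g : P1 →ₗ[Cᵐᵒᵖ] C) (m : M),
      outer g (op a • m) = (outer (a • g) m : P1 →ₗ[Cᵐᵒᵖ] M) := by
    intro a g m
    ext x
    change op (g x) • op a • m = op (a * g x) • m
    rw [MulOpposite.op_mul, mul_smul]
  have key : ∀ (g g' : P1 →ₗ[Cᵐᵒᵖ] C) (m : M), N.mkQ g = N.mkQ g' →
      Λ (outer g m) = Λ (outer g' m) := by
    intro g g' m h
    rw [Submodule.mkQ_apply, Submodule.mkQ_apply, Submodule.Quotient.eq] at h
    obtain ⟨f, hf⟩ := h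
    have : outer g m = outer g' m + (outer f m).comp d1 := by
      rw [← sub_add_cancel g g', hf, add1, add_comm]; rfl
    rw [this, map_add]
    have : Λ ((outer f m).comp d1) = 0 := hΛ ⟨_, rfl⟩
    rw [this, add_zero]
  obtain ⟨s, hs⟩ : ∃ s : Tr → (P1 →ₗ[Cᵐᵒᵖ] C), ∀ y, N.mkQ (s y) = y :=
    ⟨_, Function.rightInverse_surjInv N.mkQ_surjective⟩
  let F : M →ₗ[Cᵐᵒᵖ] DL k C Tr :=
    { toFun := fun m => DL.mk' k C (fun y => Λ (outer (s y) m))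
        (fun y y' => by
          rw [← map_add, ← add1]
          exact key _ _ _ (by rw [map_add, hs, hs, hs]))
        (fun c y => by
          rw [← smul_eq_mul, ← LinearMap.map_smul Λ, ← sm1]
          exact key _ _ _ (by rw [LinearMap.map_smul N.mkQ, hs, hs]))
      map_add' := fun m m' => by
        ext y
        change Λ _ = Λ _ + Λ _
        rw [add2, map_add]
      map_smul' := fun a m => by
        ext y
        change Λ (outer (s y) (op (unop a) • m)) = Λ (outer (s (unop a • y)) m)
        rw [sm2]
        exact key _ _ _ (by rw [LinearMap.map_smul N.mkQ, hs, hs]) }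
  have hF : F = 0 := hrigid (ModuleCat.of _ (DL k C Tr))
    ⟨P1, P0, d1, d0, hpres, ModuleCat.of _ Tr, N.mkQ, N.mkQ_surjective, fun g => by
      rw [Submodule.mkQ_apply, Submodule.Quotient.mk_eq_zero]; rfl,
      fun t y => (t : DL k C Tr) y, fun t t' y => rfl,
      fun t y y' => map_add (t : DL k C Tr) y y',
      fun c t y => DL.map_k k C (t : DL k C Tr) c y,
      fun a t y => rfl,
      fun t h => DL.ext k C h,
      fun y h => DL.sep k C y h⟩ F
  have hz : ∀ (g : P1 →ₗ[Cᵐᵒᵖ] C) (m : M), Λ (outer g m) = 0 := by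
    intro g m
    rw [key g (s (N.mkQ g)) m (hs _).symm]
    exact congrArg (fun z : M →ₗ[Cᵐᵒᵖ] DL k C Tr => z m (N.mkQ g)) hF
  apply hΛ0
  obtain ⟨n, gi, xi, hi⟩ := dualBasisR (C := C) P1
  have : h0 = ∑ i, outer (gi i) (h0 (xi i)) := by
    ext y
    conv_lhs => rw [← hi y]
    simp only [map_sum, LinearMap.map_smul, LinearMap.sum_apply, outer_apply]
  rw [this, map_sum]
  exact Finset.sum_eq_zero fun i _ => hz _ _

lemma hext (M P0 : Mdl Cᵐᵒᵖ) [Module.Finite Cᵐᵒᵖ M] (hrigid : TauRigid k C M)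
    (f : P0 →ₗ[Cᵐᵒᵖ] M) (hf : IsProjCover Cᵐᵒᵖ f) (N : Submodule Cᵐᵒᵖ M)
    (a : LinearMap.ker f →ₗ[Cᵐᵒᵖ] (M ⧸ N)) :
    ∃ h : P0 →ₗ[Cᵐᵒᵖ] (M ⧸ N), ∀ x : LinearMap.ker f, h x = a x := by
  have : IsArtinianRing Cᵐᵒᵖ := IsArtinianRing.of_finite k Cᵐᵒᵖ
  have : IsNoetherianRing Cᵐᵒᵖ := IsNoetherianRing.of_finite k Cᵐᵒᵖ
  have : Module.Finite Cᵐᵒᵖ P0 := finite_of_superfluous f hf.2.1 hf.2.2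
  obtain ⟨P1, d', hP1f, hP1, hd', hd'm⟩ := exists_cover (R := Cᵐᵒᵖ) (LinearMap.ker f)
  let d1 : P1 →ₗ[Cᵐᵒᵖ] P0 := (LinearMap.ker f).subtype.comp d'
  have hpres : IsMinPres Cᵐᵒᵖ d1 f := by
    refine ⟨hf, hP1, ?_, ?_⟩
    · rw [LinearMap.range_comp_of_range_eq_top _ (LinearMap.range_eq_top.2 hd'),
        Submodule.range_subtype]
    · intro U hU
      refine hd'm U ?_
      rw [← hU]
      congr 1
      ext z
      simp [d1]
  obtain ⟨a', ha'⟩ := lift_surj N.mkQ N.mkQ_surjective (a.comp d')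
  obtain ⟨h, hh⟩ := tau_factor k C M P1 P0 hrigid d1 f hpres a'
  refine ⟨N.mkQ.comp h, fun x => ?_⟩
  obtain ⟨y, rfl⟩ := hd' x
  have := ha' y
  rw [hh] at this
  exact this

end LemmaA


section BPart

variable (C : Type) [Ring C] (E : Type) [AddCommGroup E]
  [Module C E] [Module Cᵐᵒᵖ E] [SMulCommClass C Cᵐᵒᵖ E]

lemma B_factor {M P0 Q1 Q0 : Type} [AddCommGroup M] [Module Cᵐᵒᵖ M]
    [Module (TrivSqZeroExt C E)ᵐᵒᵖ M]
    (hM : ∀ (b : TrivSqZeroExt C E) (m : M), op b • m = op b.fst • m)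
    [AddCommGroup P0] [Module Cᵐᵒᵖ P0] [Module.Projective Cᵐᵒᵖ P0]
    (f : P0 →ₗ[Cᵐᵒᵖ] M) (hf : Function.Surjective f)
    [AddCommGroup Q1] [Module (TrivSqZeroExt C E)ᵐᵒᵖ Q1]
    [AddCommGroup Q0] [Module (TrivSqZeroExt C E)ᵐᵒᵖ Q0]
    [Module.Projective (TrivSqZeroExt C E)ᵐᵒᵖ Q0]
    (d1 : Q1 →ₗ[(TrivSqZeroExt C E)ᵐᵒᵖ] Q0) (d0 : Q0 →ₗ[(TrivSqZeroExt C E)ᵐᵒᵖ] M)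
    (hd0 : Function.Surjective d0) (hd : LinearMap.range d1 = LinearMap.ker d0)
    (hsup : ∀ U : Submodule (TrivSqZeroExt C E)ᵐᵒᵖ Q1, U ⊔ LinearMap.ker d1 = ⊤ → U = ⊤)
    (hbal : ∀ (N : Submodule Cᵐᵒᵖ M) (β : P0 → E → M ⧸ N), Bal (C := C) β → ∀ p e, β p e = 0)
    (hex : ∀ (N : Submodule Cᵐᵒᵖ M) (a : LinearMap.ker f →ₗ[Cᵐᵒᵖ] (M ⧸ N)),
      ∃ h : P0 →ₗ[Cᵐᵒᵖ] (M ⧸ N), ∀ x : LinearMap.ker f, h x = a x)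
    (g : Q1 →ₗ[(TrivSqZeroExt C E)ᵐᵒᵖ] M) :
    ∃ h : Q0 →ₗ[(TrivSqZeroExt C E)ᵐᵒᵖ] M, g = h.comp d1 := by
  letI : Module Cᵐᵒᵖ Q1 := Module.compHom Q1 (RingHom.op (tszeInl C E))
  letI : Module Cᵐᵒᵖ Q0 := Module.compHom Q0 (RingHom.op (tszeInl C E))
  have s1 : ∀ (c : C) (x : Q1), op c • x = op (TrivSqZeroExt.inl c : TrivSqZeroExt C E) • x :=
    fun _ _ => rfl
  have s0 : ∀ (c : C) (x : Q0), op c • x = op (TrivSqZeroExt.inl c : TrivSqZeroExt C E) • x :=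
    fun _ _ => rfl
  have sM : ∀ (c : C) (x : M), op (TrivSqZeroExt.inl c : TrivSqZeroExt C E) • x = op c • x :=
    fun c x => by rw [hM, TrivSqZeroExt.fst_inl]
  have sM0 : ∀ (e : E) (x : M), op (TrivSqZeroExt.inr e : TrivSqZeroExt C E) • x = 0 :=
    fun c x => by rw [hM, TrivSqZeroExt.fst_inr, MulOpposite.op_zero, zero_smul]
  let d1' : Q1 →ₗ[Cᵐᵒᵖ] Q0 :=
    { toFun := d1
      map_add' := d1.map_add
      map_smul' := fun c x => d1.map_smul (op (TrivSqZeroExt.inl (unop c))) x }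
  let d0' : Q0 →ₗ[Cᵐᵒᵖ] M :=
    { toFun := d0
      map_add' := d0.map_add
      map_smul' := fun c x => (d0.map_smul (op (TrivSqZeroExt.inl (unop c))) x).trans
        (sM (unop c) _) }
  let g1 : Q1 →ₗ[Cᵐᵒᵖ] M :=
    { toFun := g
      map_add' := g.map_add
      map_smul' := fun c x => (g.map_smul (op (TrivSqZeroExt.inl (unop c))) x).trans
        (sM (unop c) _) }
  obtain ⟨l, hl⟩ := lift_surj d0' hd0 f
  have hl' : ∀ x, d0 (l x) = f x := hl
  let N : Submodule Cᵐᵒᵖ M := (LinearMap.ker d1').map g1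
  have hdd : ∀ y, d0 (d1 y) = 0 := fun y => by
    have : d1 y ∈ LinearMap.ker d0 := hd ▸ LinearMap.mem_range_self _ _
    exact this
  have hrange : ∀ z, d0 z = 0 → z ∈ LinearMap.range d1' := fun z hz => by
    have : z ∈ LinearMap.range d1 := hd ▸ LinearMap.mem_ker.2 hz
    exact this
  obtain ⟨G, hG⟩ := descend d1'.rangeRestrict (LinearMap.surjective_rangeRestrict _)
    (N.mkQ.comp g1) (fun y hy => by
      have hy' : d1' y = 0 := congrArg Subtype.val hy
      change N.mkQ (g1 y) = 0
      rw [Submodule.mkQ_apply, Submodule.Quotient.mk_eq_zero]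
      exact ⟨y, hy', rfl⟩)
  have hG' : ∀ y h, G ⟨d1 y, h⟩ = N.mkQ (g y) := fun y h => hG y
  have hr : ∀ (p : P0) (e : E),
      op (TrivSqZeroExt.inr e : TrivSqZeroExt C E) • l p ∈ LinearMap.range d1' :=
    fun p e => hrange _ (by rw [d0.map_smul, sM0])
  let β : P0 → E → M ⧸ N := fun p e => G ⟨_, hr p e⟩
  have hβ : Bal (C := C) β :=
    { addl := fun p p' e => by
        change G _ = G _ + G _
        rw [← map_add]
        congr 1
        apply Subtype.ext
        change _ • l (p + p') = _ • l p + _ • l p'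
        rw [map_add, smul_add]
      addr := fun p e e' => by
        change G _ = G _ + G _
        rw [← map_add]
        congr 1
        apply Subtype.ext
        change op _ • l p = op _ • l p + op _ • l p
        rw [TrivSqZeroExt.inr_add, MulOpposite.op_add, add_smul]
      bal := fun c p e => by
        change G _ = G _
        congr 1
        apply Subtype.ext
        change op _ • l (op c • p) = op _ • l p
        rw [l.map_smul, s0, ← mul_smul, ← MulOpposite.op_mul, TrivSqZeroExt.inl_mul_inr]
      smul := fun c p e => by
        change G _ = op c • G _
        rw [← G.map_smul]
        congr 1
        apply Subtype.ext
        change op _ • l p = op c • (op _ • l p)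
        rw [s0, ← mul_smul, ← MulOpposite.op_mul, TrivSqZeroExt.inr_mul_inl] }
  have hβ0 := hbal N β hβ
  obtain ⟨h0, hh0⟩ := hex N (G.comp ((l.comp (LinearMap.ker f).subtype).codRestrict _ (fun x =>
    hrange _ ((hl' _).trans x.2))))
  have hh0' : ∀ x (hx : f x = 0), h0 x = G ⟨l x, hrange _ ((hl' _).trans hx)⟩ :=
    fun x hx => hh0 ⟨x, hx⟩
  have hdec : ∀ z, ∃ a b, l a + d1' b = z := by
    intro z
    obtain ⟨a, ha⟩ := hf (d0 z)
    obtain ⟨b, hb⟩ := hrange (z - l a) (by rw [map_sub, hl', ha, sub_self])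
    exact ⟨a, b, by rw [hb]; abel⟩
  obtain ⟨u, hul, hud⟩ := glue l d1' hdec h0 (N.mkQ.comp g1) (fun x y hxy => by
    have hxy' : l x = d1 (-y) := by
      rw [map_neg]; exact eq_neg_of_add_eq_zero_left hxy
    have hx : f x = 0 := by rw [← hl', hxy', hdd]
    rw [hh0' x hx]
    have : G ⟨l x, hrange _ ((hl' _).trans hx)⟩ = N.mkQ (g (-y)) := by
      rw [← hG' (-y) (LinearMap.mem_range_self d1' (-y))]
      congr 1
      exact Subtype.ext hxy'
    rw [this, map_neg, map_neg]
    exact neg_add_cancel (N.mkQ (g y)))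
  have hud' : ∀ y, u (d1 y) = N.mkQ (g y) := hud
  have huz : ∀ (e : E) z, u (op (TrivSqZeroExt.inr e : TrivSqZeroExt C E) • z) = 0 := by
    intro e z
    obtain ⟨a, b, rfl⟩ := hdec z
    rw [smul_add, map_add]
    have t1 : u (op (TrivSqZeroExt.inr e : TrivSqZeroExt C E) • l a) = 0 := by
      obtain ⟨y, hy⟩ := hr a e
      have hy' : d1 y = op (TrivSqZeroExt.inr e : TrivSqZeroExt C E) • l a := hy
      rw [← hβ0 a e, ← hy', hud', ← hG' y (LinearMap.mem_range_self d1' y)]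
      change _ = G _
      congr 1
      exact Subtype.ext hy'
    have t2 : u (op (TrivSqZeroExt.inr e : TrivSqZeroExt C E) • d1' b) = 0 := by
      change u (op (TrivSqZeroExt.inr e : TrivSqZeroExt C E) • d1 b) = 0
      rw [← d1.map_smul, hud', g.map_smul, sM0, map_zero]
    rw [t1, t2, add_zero]
  letI : Module (TrivSqZeroExt C E)ᵐᵒᵖ (M ⧸ N) := Module.compHom (M ⧸ N) (RingHom.op (tszeFst C E))
  let mk' : M →ₗ[(TrivSqZeroExt C E)ᵐᵒᵖ] (M ⧸ N) :=
    { toFun := N.mkQ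
      map_add' := N.mkQ.map_add
      map_smul' := fun b m => (congrArg N.mkQ (hM (unop b) m)).trans (N.mkQ.map_smul _ _) }
  let u' : Q0 →ₗ[(TrivSqZeroExt C E)ᵐᵒᵖ] (M ⧸ N) :=
    { toFun := u
      map_add' := u.map_add
      map_smul' := fun b z => by
        have hb : b = op (TrivSqZeroExt.inl (unop b).fst) + op (TrivSqZeroExt.inr (unop b).snd) := by
          rw [← MulOpposite.op_add, TrivSqZeroExt.inl_fst_add_inr_snd_eq]; rfl
        conv_lhs => rw [hb, add_smul, map_add, huz, add_zero]
        exact u.map_smul (op (unop b).fst) z }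
  obtain ⟨h, hh⟩ := lift_surj mk' N.mkQ_surjective u'
  have hh' : ∀ z, N.mkQ (h z) = u z := hh
  refine ⟨h, ?_⟩
  have key : LinearMap.ker (g - h.comp d1) = ⊤ := by
    apply hsup
    rw [eq_top_iff]
    intro y _
    have hy : N.mkQ ((g - h.comp d1) y) = 0 := by
      rw [LinearMap.sub_apply, map_sub, LinearMap.comp_apply, hh', hud', sub_self]
    rw [Submodule.mkQ_apply, Submodule.Quotient.mk_eq_zero] at hy
    obtain ⟨y', hy1, hy2⟩ := hy
    have hy1' : d1 y' = 0 := hy1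
    have hy2' : g y' = (g - h.comp d1) y := hy2
    rw [← sub_add_cancel y y']
    refine Submodule.add_mem_sup ?_ hy1'
    rw [LinearMap.mem_ker, map_sub, ← hy2', LinearMap.sub_apply, LinearMap.comp_apply, hy1',
      map_zero, sub_zero, sub_self]
  rw [LinearMap.ker_eq_top] at key
  exact sub_eq_zero.1 key

end BPart


theorem finite_transfer {R S M : Type*} [Ring R] [Ring S] [AddCommGroup M] [Module R M]
    [Module S M] [hf : Module.Finite R M] (h : ∀ a : R, ∃ b : S, ∀ x : M, b • x = a • x) :
    Module.Finite S M := by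
  obtain ⟨s, hs⟩ := hf.fg_top
  refine ⟨⟨s, ?_⟩⟩
  rw [eq_top_iff]
  intro m _
  have hm : m ∈ Submodule.span R (s : Set M) := hs ▸ Submodule.mem_top
  induction hm using Submodule.span_induction with
  | mem x hx => exact Submodule.subset_span hx
  | zero => exact Submodule.zero_mem _
  | add x y _ _ hx hy => exact Submodule.add_mem _ (hx trivial) (hy trivial)
  | smul a x _ hx =>
    obtain ⟨b, hb⟩ := h a
    rw [← hb]
    exact Submodule.smul_mem _ b (hx trivial)

section Final

lemma main_aux
    (k : Type) [Field k] (C : Type) [Ring C] [Algebra k C] [FiniteDimensional k C]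
    (E : Type) [AddCommGroup E] [Module C E] [Module Cᵐᵒᵖ E] [SMulCommClass C Cᵐᵒᵖ E]
    [Module k E] [IsScalarTower k C E] [IsScalarTower k Cᵐᵒᵖ E]
    (hgl : GlDimLE2 Cᵐᵒᵖ) (hE : IsRelExt k C E)
    (M : Mdl Cᵐᵒᵖ) [Module.Finite Cᵐᵒᵖ M]
    (hrigid : TauRigid k C M)
    (P0 : Mdl Cᵐᵒᵖ) (f : P0 →ₗ[Cᵐᵒᵖ] M) (hf : IsProjCover Cᵐᵒᵖ f)
    (hbal : ∀ (N : Submodule Cᵐᵒᵖ M) (β : P0 → E → M ⧸ N), Bal (C := C) β → ∀ p e, β p e = 0) :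
    TauRigid k (TrivSqZeroExt C E) (modB C E M) := by
  have : Module.Finite Cᵐᵒᵖ E := E_finite k C E hgl hE
  have : Module.Finite k E := Module.Finite.trans Cᵐᵒᵖ E
  have : Module.Finite k (TrivSqZeroExt C E) := inferInstanceAs (Module.Finite k (C × E))
  have : Module.Finite k (TrivSqZeroExt C E)ᵐᵒᵖ := inferInstance
  have : IsNoetherianRing (TrivSqZeroExt C E)ᵐᵒᵖ := IsNoetherianRing.of_finite k _
  classical
  have hP0 := hf.1
  intro T hT
  obtain ⟨Q1, Q0, d1, d0, ⟨⟨hQ0, hd0, hd0s⟩, hQ1, hd, hd1s⟩, Tr, q, hq, hqz, hdual⟩ := hT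
  have hMf : Module.Finite (TrivSqZeroExt C E)ᵐᵒᵖ (modB C E M) := by
    letI : Module (TrivSqZeroExt C E)ᵐᵒᵖ M := Module.compHom M (RingHom.op (tszeFst C E))
    exact finite_transfer (R := Cᵐᵒᵖ) (S := (TrivSqZeroExt C E)ᵐᵒᵖ) (M := M)
      (fun a => ⟨op (TrivSqZeroExt.inl (unop a)), fun x => rfl⟩)
  have hQ0f : Module.Finite (TrivSqZeroExt C E)ᵐᵒᵖ Q0 := finite_of_superfluous d0 hd0 hd0s
  have hQ1f : Module.Finite (TrivSqZeroExt C E)ᵐᵒᵖ Q1 := by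
    refine finite_of_superfluous d1.rangeRestrict (LinearMap.surjective_rangeRestrict _) ?_
    intro U hU
    rw [LinearMap.ker_rangeRestrict] at hU
    exact hd1s U hU
  refine tau_zero k (TrivSqZeroExt C E) (modB C E M) T Q1 Q0 d1 ?_ Tr q hq hqz hdual
  letI : Module (TrivSqZeroExt C E)ᵐᵒᵖ M := Module.compHom M (RingHom.op (tszeFst C E))
  exact B_factor C E (M := M) (fun b m => rfl) f hf.2.1 d1 d0 hd0 hd hd1s hbal
    (fun N a => hext k C M P0 hrigid f hf N a)

end Final

end TB

/-- If `M` is `τ_C`-rigid with projective cover `P0 → M` and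
`Hom_C(τ⁻¹ Ω⁻¹ P0, Gen M) = 0`, then `M` is `τ_B`-rigid; in particular this
holds if `pd_C X ≤ 1` for every `X ∈ Gen M`. -/
theorem tauB_rigid_of_hom_gen_vanish
    (k : Type) [Field k] (C : Type) [Ring C] [Algebra k C] [FiniteDimensional k C]
    (E : Type) [AddCommGroup E] [Module C E] [Module Cᵐᵒᵖ E] [SMulCommClass C Cᵐᵒᵖ E]
    [Module k E] [IsScalarTower k C E] [IsScalarTower k Cᵐᵒᵖ E]
    (hgl : GlDimEq2 Cᵐᵒᵖ) (hE : IsRelExt k C E)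
    (M : Mdl Cᵐᵒᵖ) [Module.Finite Cᵐᵒᵖ M]
    (hrigid : TauRigid k C M)
    (P0 : Mdl Cᵐᵒᵖ) (f : P0 →ₗ[Cᵐᵒᵖ] M) (hf : IsProjCover Cᵐᵒᵖ f) :
    ((∀ W, IsTauInvCosyz k C P0 W →
        ∀ X, MemGen Cᵐᵒᵖ M X → HomZero Cᵐᵒᵖ W X) →
      TauRigid k (TrivSqZeroExt C E) (modB C E M)) ∧
    ((∀ X, MemGen Cᵐᵒᵖ M X → PdLE1 Cᵐᵒᵖ X) →
      TauRigid k (TrivSqZeroExt C E) (modB C E M)) := by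
  have hfin : Module.Finite Cᵐᵒᵖ P0 := TB.finite_of_superfluous f hf.2.1 hf.2.2
  have hproj := hf.1
  have hgen : ∀ N : Submodule Cᵐᵒᵖ M, MemGen Cᵐᵒᵖ M (ModuleCat.of Cᵐᵒᵖ (M ⧸ N)) := fun N =>
    ⟨1, N.mkQ.comp (LinearMap.proj 0), fun x => by
      obtain ⟨m, rfl⟩ := N.mkQ_surjective x
      exact ⟨fun _ => m, rfl⟩⟩
  constructor
  · intro h
    exact TB.main_aux k C E hgl.1 hE M hrigid P0 f hf (fun N β hβ =>
      TB.bal_zero_a k C E hgl.1 hE P0 (ModuleCat.of Cᵐᵒᵖ (M ⧸ N))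
        (fun W hW => h W hW _ (hgen N)) β hβ)
  · intro h
    exact TB.main_aux k C E hgl.1 hE M hrigid P0 f hf (fun N β hβ =>
      TB.bal_zero_b k C E hgl.1 hE P0 (ModuleCat.of Cᵐᵒᵖ (M ⧸ N)) (h _ (hgen N)) β hβ)
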